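/- Restriction theorem for tameness: Let A be an essential hyperplane arrangement in V = K^ℓ and H ∈ A. If A and A' = A∖{H} are both tame, and A is locally free along H, then the restricted arrangement A^H is tame. -/

import Mathlib

noncomputable section
open Classical MvPolynomial

/-- `pdLE R n M` : the `R`-module `M` has projective dimension at most `n`. -/
def pdLE (R : Type) [CommRing R] : ℕ → (M : Type) → [AddCommGroup M] → [Module R M] → Prop
  | 0, M, _, _ => Module.Projective R M
  | n + 1, M, _, _ => ∃ (ι : Type) (f : (ι →₀ R) →ₗ[R] M),
      Function.Surjective f ∧ pdLE R n (LinearMap.ker f)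

/-- Projective dimension as an element of `ℕ∞`. -/
def pdim (R : Type) [CommRing R] (M : Type) [AddCommGroup M] [Module R M] : ℕ∞ :=
  sInf {n : ℕ∞ | ∃ k : ℕ, pdLE R k M ∧ n = (k : ℕ∞)}

/-- The coordinate ring `S = K[x_1, …, x_ℓ]`. -/
abbrev PS (K : Type) [Field K] (ℓ : ℕ) : Type := MvPolynomial (Fin ℓ) K

/-- The free `S`-module of polynomial differential forms of all degrees, realized as the
exterior algebra over `S` on the free module `S^ℓ` (with `dx_i` the standard basis). -/
abbrev ExtF (K : Type) [Field K] (ℓ : ℕ) : Type :=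
  ExteriorAlgebra (PS K ℓ) (Fin ℓ → PS K ℓ)

variable {K : Type} [Field K] {ℓ : ℕ}

/-- The module `Ω^p_V` of polynomial differential `p`-forms. -/
def formsP (K : Type) [Field K] (ℓ : ℕ) (p : ℕ) : Submodule (PS K ℓ) (ExtF K ℓ) :=
  (LinearMap.range (ExteriorAlgebra.ι (PS K ℓ) :
      (Fin ℓ → PS K ℓ) →ₗ[PS K ℓ] ExtF K ℓ)) ^ p

/-- The defining linear form `α = ∑ c_i x_i` of the hyperplane with coefficient vector `c`. -/
def linP (c : Fin ℓ → K) : PS K ℓ := ∑ i, MvPolynomial.C (c i) * MvPolynomial.X i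

/-- The constant one-form `dα = ∑ c_i dx_i`. -/
def dP (c : Fin ℓ → K) : ExtF K ℓ :=
  ExteriorAlgebra.ι (PS K ℓ) (fun i => MvPolynomial.C (c i))

/-- A central hyperplane arrangement in `K^ℓ`: a finite set of (pairwise non-proportional,
nonzero) coefficient vectors of defining linear forms, each representing the hyperplane
`{x : ∑ c_i x_i = 0}`. -/
structure Arrangement (K : Type) [Field K] (ℓ : ℕ) : Type where
  hyps : Finset (Fin ℓ → K)
  ne_zero : ∀ c ∈ hyps, c ≠ 0
  nonprop : ∀ c ∈ hyps, ∀ c' ∈ hyps, c ≠ c' → ∀ t : K, c ≠ t • c'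

/-- The polynomial model of the module `Ω^p(A,m)` of logarithmic `p`-forms of the
multiarrangement `(A,m)`; it is `Q(A,m)·Ω^p(A,m)`, i.e. the image of `Ω^p(A,m)` under the
degree-shifting isomorphism given by multiplication with `Q(A,m)`, so that
`η = Q(A,m)·ω` ranges over polynomial `p`-forms with `dα_H ∧ η ∈ α_H^{m(H)} Ω^{p+1}_V`
for all `H ∈ A`. -/
def Omega (A : Arrangement K ℓ) (m : (Fin ℓ → K) → ℕ) (p : ℕ) :
    Submodule (PS K ℓ) (ExtF K ℓ) :=
  formsP K ℓ p ⊓ ⨅ c ∈ A.hyps,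
    Submodule.comap (LinearMap.mulLeft (PS K ℓ) (dP c))
      (Submodule.map (LinearMap.lsmul (PS K ℓ) (ExtF K ℓ) (linP c ^ m c))
        (formsP K ℓ (p + 1)))

/-- Tameness of a multiarrangement: `pd_S Ω^p(A,m) ≤ p` for all `0 ≤ p ≤ ℓ`. -/
def TameM (A : Arrangement K ℓ) (m : (Fin ℓ → K) → ℕ) : Prop :=
  ∀ p : ℕ, p ≤ ℓ → pdLE (PS K ℓ) p (Omega A m p)

/-- Tameness of a simple arrangement (constant multiplicity `1`). -/
def Tame (A : Arrangement K ℓ) : Prop := TameM A (fun _ => 1)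

/-- Freeness of a multiarrangement: `Ω^1(A,m)` is a free `S`-module. -/
def FreeM (A : Arrangement K ℓ) (m : (Fin ℓ → K) → ℕ) : Prop :=
  Module.Free (PS K ℓ) (Omega A m 1)

/-- An arrangement is essential when the intersection of its hyperplanes is `{0}`,
equivalently the defining forms span the dual space. -/
def Essential (A : Arrangement K ℓ) : Prop :=
  Submodule.span K (A.hyps : Set (Fin ℓ → K)) = ⊤

/-- The localization `A_x = {H ∈ A : x ∈ H}` of an arrangement at a point `x`. -/
def locArr (A : Arrangement K ℓ) (x : Fin ℓ → K) : Arrangement K ℓ where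
  hyps := A.hyps.filter (fun c => ∑ i, c i * x i = 0)
  ne_zero := fun c hc => A.ne_zero c (Finset.mem_filter.mp hc).1
  nonprop := fun c hc c' hc' =>
    A.nonprop c (Finset.mem_filter.mp hc).1 c' (Finset.mem_filter.mp hc').1

/-- `(A,m)` is locally free along the hyperplane `{x : ∑ (c0)_i x_i = 0}` :
`(A_x, m_x)` is free for every nonzero point `x` of this hyperplane. -/
def LocallyFreeAlong (A : Arrangement K ℓ) (m : (Fin ℓ → K) → ℕ) (c0 : Fin ℓ → K) : Prop :=
  ∀ x : Fin ℓ → K, x ≠ 0 → (∑ i, c0 i * x i = 0) → FreeM (locArr A x) m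

/-- The deletion `A ∖ {H}`. -/
def delArr (A : Arrangement K ℓ) (c0 : Fin ℓ → K) : Arrangement K ℓ where
  hyps := A.hyps.erase c0
  ne_zero := fun c hc => A.ne_zero c (Finset.mem_of_mem_erase hc)
  nonprop := fun c hc c' hc' =>
    A.nonprop c (Finset.mem_of_mem_erase hc) c' (Finset.mem_of_mem_erase hc')

/-- The coefficient vector of the restriction of the linear form `c` to the hyperplane `H`
along the linear identification `e : K^{ℓ-1} ≃ H`. -/
def restrictForm (e : (Fin (ℓ - 1) → K) →ₗ[K] (Fin ℓ → K)) (c : Fin ℓ → K) :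
    Fin (ℓ - 1) → K := fun i => ∑ j, c j * e (Pi.single i 1) j

/-- The linear form on `K^ℓ` with coefficient vector `c`. -/
def dotLin (c : Fin ℓ → K) : (Fin ℓ → K) →ₗ[K] K := ∑ i, c i • LinearMap.proj i

/-- `e` identifies `K^{ℓ-1}` with the hyperplane `ker(α_{c0})`. -/
def IsHypEmbedding (c0 : Fin ℓ → K) (e : (Fin (ℓ - 1) → K) →ₗ[K] (Fin ℓ → K)) : Prop :=
  Function.Injective e ∧ LinearMap.range e = LinearMap.ker (dotLin c0)

/-- `B` (an arrangement in `K^{ℓ-1}`) represents the restriction `A^H` of `A` to the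
hyperplane `H` determined by `c0 ∈ A`, via the identification `e : K^{ℓ-1} ≃ H`:
its hyperplanes are exactly the restrictions to `H` of the hyperplanes of `A ∖ {H}`. -/
def IsRestrictionOf (B : Arrangement K (ℓ - 1)) (A : Arrangement K ℓ) (c0 : Fin ℓ → K)
    (e : (Fin (ℓ - 1) → K) →ₗ[K] (Fin ℓ → K)) : Prop :=
  (∀ c ∈ A.hyps, c ≠ c0 → ∃ c' ∈ B.hyps, ∃ t : K, t ≠ 0 ∧ restrictForm e c = t • c') ∧
  (∀ c' ∈ B.hyps, ∃ c ∈ A.hyps, c ≠ c0 ∧ ∃ t : K, t ≠ 0 ∧ restrictForm e c = t • c')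
/-- The Ziegler multiplicity `m^H` on the restriction: `m^H(X) = #{L ∈ A∖{H} : L ∩ H = X}`. -/
def zieglerMult (A : Arrangement K ℓ) (c0 : Fin ℓ → K)
    (e : (Fin (ℓ - 1) → K) →ₗ[K] (Fin ℓ → K)) (c' : Fin (ℓ - 1) → K) : ℕ :=
  (A.hyps.filter (fun c => c ≠ c0 ∧ ∃ t : K, t ≠ 0 ∧ restrictForm e c = t • c')).card

/-- The wedge `dx_{i_1} ∧ ⋯ ∧ dx_{i_p}` for a list of indices. -/
def wedgeList (l : List (Fin ℓ)) : ExtF K ℓ :=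
  (l.map (fun i => ExteriorAlgebra.ι (PS K ℓ) (Pi.single i (1 : PS K ℓ)))).prod

/-- A polynomial `p`-form is homogeneous of (coefficient) degree `d` if it is a sum of
terms `f · dx_{i_1} ∧ ⋯ ∧ dx_{i_p}` with `f` homogeneous of degree `d`. -/
def IsHomogForm (p d : ℕ) (η : ExtF K ℓ) : Prop :=
  η ∈ AddSubgroup.closure {ξ : ExtF K ℓ | ∃ (f : PS K ℓ) (l : List (Fin ℓ)),
    f.IsHomogeneous d ∧ l.length = p ∧ ξ = f • wedgeList l}

/-- `|m| = ∑_{H ∈ A} m(H)`. -/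
def msum (A : Arrangement K ℓ) (m : (Fin ℓ → K) → ℕ) : ℕ := ∑ c ∈ A.hyps, m c

/-- The multiarrangement `(A,m)` is free with exponents `(d_1, …, d_ℓ)`: the polynomial
model of `Ω^1(A,m)` has a homogeneous basis whose `i`-th member has coefficient degree
`|m| - d_i`. -/
def FreeWithExp (A : Arrangement K ℓ) (m : (Fin ℓ → K) → ℕ) (d : Fin ℓ → ℕ) : Prop :=
  ∃ b : Fin ℓ → ExtF K ℓ,
    (∀ i, b i ∈ Omega A m 1) ∧
    (∀ i, IsHomogForm 1 (msum A m - d i) (b i)) ∧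
    LinearIndependent (PS K ℓ) b ∧
    Omega A m 1 ≤ Submodule.span (PS K ℓ) (Set.range b)

/-- The exponent vector `(d_1, d_2, 0, …, 0)`. -/
def expVec (d1 d2 : ℕ) : Fin ℓ → ℕ := fun i =>
  if (i : ℕ) = 0 then d1 else if (i : ℕ) = 1 then d2 else 0

/-- The localization `A_X` of `A` at the lattice element `X = H ∩ L` corresponding,
via the identification `e` of `H` with `K^{ℓ-1}`, to the hyperplane of `H`
with coefficient vector `c'`. -/
def locOnRestr (A : Arrangement K ℓ) (e : (Fin (ℓ - 1) → K) →ₗ[K] (Fin ℓ → K))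
    (c' : Fin (ℓ - 1) → K) : Arrangement K ℓ where
  hyps := A.hyps.filter (fun c => ∃ t : K, restrictForm e c = t • c')
  ne_zero := fun c hc => A.ne_zero c (Finset.mem_filter.mp hc).1
  nonprop := fun c hc c'' hc'' =>
    A.nonprop c (Finset.mem_filter.mp hc).1 c'' (Finset.mem_filter.mp hc'').1

/-- The multiplicity `m - δ_H`. -/
def mdel (m : (Fin ℓ → K) → ℕ) (c0 : Fin ℓ → K) : (Fin ℓ → K) → ℕ :=
  fun c => if c = c0 then m c - 1 else m c

/-- `ms` is the Euler multiplicity `m^*` on the restriction `B = A^H` (presented via the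
identification `e`): for each `X ∈ A^H` the rank-two localization `(A_X, m_X)` is free
with exponents `(d_1^X, d_2^X, 0, …, 0)` ordered so that `(A_X, m_X - δ_H)` is free with
exponents `(d_1^X - 1, d_2^X, 0, …, 0)`, and `m^*(X) = d_2^X`. -/
def IsEulerMult (A : Arrangement K ℓ) (m : (Fin ℓ → K) → ℕ) (c0 : Fin ℓ → K)
    (e : (Fin (ℓ - 1) → K) →ₗ[K] (Fin ℓ → K)) (B : Arrangement K (ℓ - 1))
    (ms : (Fin (ℓ - 1) → K) → ℕ) : Prop :=
  ∀ c' ∈ B.hyps, ∃ d1 d2 : ℕ,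
    FreeWithExp (locOnRestr A e c') m (expVec d1 d2) ∧
    FreeWithExp (locOnRestr A e c') (mdel m c0) (expVec (d1 - 1) d2) ∧
    ms c' = d2

/-- An arrangement is generic if any `k ≤ ℓ-1` of its hyperplanes intersect in
codimension `k`, i.e. any `≤ ℓ-1` of its defining forms are linearly independent. -/
def GenericArr (A : Arrangement K ℓ) : Prop :=
  ∀ s : Finset (Fin ℓ → K), s ⊆ A.hyps → s.card ≤ ℓ - 1 →
    LinearIndependent K (fun x : {c // c ∈ s} => (x : Fin ℓ → K))

/-- An arrangement is irreducible if it is not a product of two lower-dimensional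
arrangements, i.e. its defining forms cannot be split into two complementary proper
subspaces of the dual space. -/
def IrreducibleArr (A : Arrangement K ℓ) : Prop :=
  ¬ ∃ U1 U2 : Submodule K (Fin ℓ → K), U1 ≠ ⊥ ∧ U2 ≠ ⊥ ∧ U1 ⊓ U2 = ⊥ ∧ U1 ⊔ U2 = ⊤ ∧
      ∀ c ∈ A.hyps, c ∈ U1 ∨ c ∈ U2

/-- The defining polynomial `Q(A,m) = ∏_{H ∈ A} α_H^{m(H)}`. -/
def Qpoly (A : Arrangement K ℓ) (m : (Fin ℓ → K) → ℕ) : PS K ℓ :=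
  ∏ c ∈ A.hyps, linP c ^ m c

section ProjectiveDimension

open CategoryTheory

variable {R : Type} [CommRing R]

lemma pdLE_iff_hasProjectiveDimensionLE (n : ℕ) (M : Type) [AddCommGroup M] [Module R M] :
    pdLE R n M ↔ HasProjectiveDimensionLT (ModuleCat.of R M) (n + 1) := by
  induction n generalizing M with
  | zero =>
    rw [zero_add, ← projective_iff_hasProjectiveDimensionLT_one, ← IsProjective.iff_projective]
    rfl
  | succ n ih =>
    constructor
    · rintro ⟨ι, f, hf, hk⟩
      have hS := LinearMap.shortExact_shortComplexKer hf
      refine hS.hasProjectiveDimensionLT_X₃ (n + 1) ((ih _).1 hk) ?_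
      have : Projective (ModuleCat.of R (ι →₀ R)) := (IsProjective.iff_projective _).1 inferInstance
      exact hasProjectiveDimensionLT_of_ge _ 1 _ (by omega)
    · intro h
      refine ⟨M, Finsupp.linearCombination R id, Finsupp.linearCombination_id_surjective R M, ?_⟩
      rw [ih]
      have hS := LinearMap.shortExact_shortComplexKer
        (Finsupp.linearCombination_id_surjective R M)
      refine hS.hasProjectiveDimensionLT_X₁ (n + 1) ?_ h
      have : Projective (ModuleCat.of R (M →₀ R)) := (IsProjective.iff_projective _).1 inferInstance
      exact hasProjectiveDimensionLT_of_ge _ 1 _ (by omega)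

variable {M N L : Type} [AddCommGroup M] [Module R M] [AddCommGroup N] [Module R N]
  [AddCommGroup L] [Module R L]

lemma pdLE_of_linearEquiv (e : M ≃ₗ[R] N) {n : ℕ} (h : pdLE R n M) : pdLE R n N := by
  rw [pdLE_iff_hasProjectiveDimensionLE] at h ⊢
  exact hasProjectiveDimensionLT_of_iso e.toModuleIso _

lemma pdLE_mono {m n : ℕ} (hmn : m ≤ n) (h : pdLE R m M) : pdLE R n M := by
  rw [pdLE_iff_hasProjectiveDimensionLE] at h ⊢
  exact hasProjectiveDimensionLT_of_ge _ (m + 1) _ (by omega)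

lemma pdLE_of_projective [Module.Projective R M] (n : ℕ) : pdLE R n M :=
  pdLE_mono (Nat.zero_le n) (show Module.Projective R M from inferInstance)

lemma shortExact_of_exact {f : M →ₗ[R] N} {g : N →ₗ[R] L} (hf : Function.Injective f)
    (hfg : Function.Exact f g) (hg : Function.Surjective g) :
    (ModuleCat.shortComplexOfCompEqZero f g hfg.linearMap_comp_eq_zero).ShortExact :=
  ModuleCat.shortComplex_shortExact _ hfg hf hg

lemma pdLE_right {f : M →ₗ[R] N} {g : N →ₗ[R] L} (hf : Function.Injective f)
    (hfg : Function.Exact f g) (hg : Function.Surjective g) {n : ℕ}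
    (hM : pdLE R n M) (hN : pdLE R (n + 1) N) : pdLE R (n + 1) L := by
  rw [pdLE_iff_hasProjectiveDimensionLE] at hM hN ⊢
  exact (shortExact_of_exact hf hfg hg).hasProjectiveDimensionLT_X₃ (n + 1) hM hN

lemma pdLE_left {f : M →ₗ[R] N} {g : N →ₗ[R] L} (hf : Function.Injective f)
    (hfg : Function.Exact f g) (hg : Function.Surjective g) {n : ℕ}
    (hN : pdLE R n N) (hL : pdLE R (n + 1) L) : pdLE R n M := by
  rw [pdLE_iff_hasProjectiveDimensionLE] at hN hL ⊢
  exact (shortExact_of_exact hf hfg hg).hasProjectiveDimensionLT_X₁ (n + 1) hN hL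

lemma pdLE_ker {g : N →ₗ[R] L} (hg : Function.Surjective g) {n : ℕ}
    (hN : pdLE R n N) (hL : pdLE R (n + 1) L) : pdLE R n (LinearMap.ker g) :=
  pdLE_left (LinearMap.ker g).injective_subtype g.exact_subtype_ker_map hg hN hL

lemma pdLE_of_surjective {g : N →ₗ[R] L} (hg : Function.Surjective g) {n : ℕ}
    (hN : pdLE R (n + 1) N) (hk : pdLE R n (LinearMap.ker g)) : pdLE R (n + 1) L :=
  pdLE_right (LinearMap.ker g).injective_subtype g.exact_subtype_ker_map hg hk hN

/-- The kernel of a map of projective modules is a second syzygy. -/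
lemma pdLE_ker_of_projective [Module.Projective R N] [Module.Projective R L] (g : N →ₗ[R] L)
    {n : ℕ} (h : pdLE R (n + 2) (L ⧸ LinearMap.range g)) : pdLE R n (LinearMap.ker g) := by
  have h1 : pdLE R (n + 1) (LinearMap.range g) := by
    refine pdLE_left (LinearMap.range g).injective_subtype
      (LinearMap.exact_subtype_mkQ (LinearMap.range g)) (Submodule.mkQ_surjective _)
      (pdLE_of_projective _) h
  have h2 := pdLE_ker g.surjective_rangeRestrict (pdLE_of_projective (M := N) n) h1
  rwa [LinearMap.ker_rangeRestrict] at h2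

variable (R) in
/-- Every `R`-module has projective dimension at most `n`. -/
def GlobalDimLE (n : ℕ) : Prop :=
  ∀ (M : Type) [AddCommGroup M] [Module R M], pdLE R n M

lemma GlobalDimLE.of_ringEquiv {R' : Type} [CommRing R'] (e : R ≃+* R') {n : ℕ}
    (h : GlobalDimLE R n) : GlobalDimLE R' n := by
  intro M _ _
  let : Module R M := Module.compHom M e.toRingHom
  have h1 := (pdLE_iff_hasProjectiveDimensionLE n M).1 (h M)
  rw [pdLE_iff_hasProjectiveDimensionLE]
  have : RingHomInvPair (RingHomClass.toRingHom e) (RingHomClass.toRingHom e.symm) :=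
    RingHomInvPair.of_ringEquiv e
  have : RingHomInvPair (RingHomClass.toRingHom e.symm) (RingHomClass.toRingHom e) :=
    RingHomInvPair.of_ringEquiv e.symm
  let e' : (ModuleCat.of R M) ≃ₛₗ[RingHomClass.toRingHom e] (ModuleCat.of R' M) :=
    { AddEquiv.refl M with
      map_smul' := fun r m => rfl }
  have : HasProjectiveDimensionLE (ModuleCat.of R M) n := h1
  exact ModuleCat.hasProjectiveDimensionLE_of_semiLinearEquiv e e' n

end ProjectiveDimension

section Syzygy

open scoped TensorProduct Polynomial

lemma pdLE.baseChange {R : Type} [CommRing R] (S : Type) [CommRing S] [Algebra R S]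
    [Module.Flat R S] {n : ℕ} {M : Type} [AddCommGroup M] [Module R M] (h : pdLE R n M) :
    pdLE S n (S ⊗[R] M) := by
  induction n generalizing M with
  | zero =>
    have : Module.Projective R M := h
    exact (inferInstance : Module.Projective S (S ⊗[R] M))
  | succ n ih =>
    obtain ⟨ι, f, hf, hk⟩ := h
    have key : ∀ {A B C : Type} [AddCommGroup A] [AddCommGroup B] [AddCommGroup C] [Module R A]
      [Module R B] [Module R C] (u : A →ₗ[R] B) (v : B →ₗ[R] C), Function.Injective u →
      Function.Exact u v → Function.Surjective v → pdLE S n (S ⊗[R] A) →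
      Module.Projective R B → pdLE S (n + 1) (S ⊗[R] C) := by
      intro A B C _ _ _ _ _ _ u v hu huv hv hA hB
      refine pdLE_right (f := u.baseChange S) (g := v.baseChange S) ?_ ?_ ?_ hA
        (pdLE_of_projective _)
      · exact Module.Flat.lTensor_preserves_injective_linearMap u hu
      · exact lTensor_exact S huv hv
      · exact LinearMap.lTensor_surjective S hv
    exact key _ f (LinearMap.ker f).injective_subtype f.exact_subtype_ker_map hf (ih hk)
      inferInstance

variable {R : Type} [CommRing R] {M : Type} [AddCommGroup M] [Module R M] [Module R[X] M]
  [IsScalarTower R R[X] M]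

variable (R M) in
/-- Multiplication by the variable, as an `R`-linear endomorphism of an `R[X]`-module. -/
def mulVar : M →ₗ[R] M := (LinearMap.lsmul R[X] M Polynomial.X).restrictScalars R

variable (R M) in
/-- The characteristic map `X ⊗ 1 - 1 ⊗ X`. -/
def charMap : R[X] ⊗[R] M →ₗ[R[X]] R[X] ⊗[R] M :=
  LinearMap.lsmul R[X] _ Polynomial.X - (mulVar R M).baseChange R[X]

variable (R M) in
/-- The evaluation map `R[X] ⊗ M → M`. -/
def charEval : R[X] ⊗[R] M →ₗ[R[X]] M :=
  LinearMap.liftBaseChange R[X] (LinearMap.id : M →ₗ[R] M)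

lemma charEval_tmul (p : R[X]) (m : M) : charEval R M (p ⊗ₜ m) = p • m := by
  simp [charEval]

lemma charMap_tmul (p : R[X]) (m : M) :
    charMap R M (p ⊗ₜ m) = (Polynomial.X * p) ⊗ₜ m - p ⊗ₜ ((Polynomial.X : R[X]) • m) := by
  simp [charMap, mulVar, TensorProduct.smul_tmul']

lemma sub_charEval_mem_range (t : R[X] ⊗[R] M) :
    t - 1 ⊗ₜ charEval R M t ∈ LinearMap.range (charMap R M) := by
  induction t with
  | zero => simp
  | add x y hx hy =>
    have := add_mem hx hy
    rw [map_add, TensorProduct.tmul_add]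
    convert this using 1
    abel
  | tmul p m =>
    rw [charEval_tmul]
    induction p using Polynomial.induction_on generalizing m with
    | C a =>
      have : (Polynomial.C a : R[X]) ⊗ₜ[R] m = 1 ⊗ₜ (Polynomial.C a • m) := by
        rw [← Polynomial.algebraMap_eq, Algebra.algebraMap_eq_smul_one, TensorProduct.smul_tmul,
          smul_assoc, one_smul]
      rw [this, sub_self]
      exact zero_mem _
    | add p q hp hq =>
      have := add_mem (hp m) (hq m)
      rw [TensorProduct.add_tmul, add_smul, TensorProduct.tmul_add]
      convert this using 1
      abel
    | monomial n a ih =>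
      have h1 := ih ((Polynomial.X : R[X]) • m)
      have h2 : charMap R M ((Polynomial.C a * Polynomial.X ^ n) ⊗ₜ m) ∈
        LinearMap.range (charMap R M) := ⟨_, rfl⟩
      rw [charMap_tmul] at h2
      have := add_mem h1 h2
      rw [smul_smul] at this
      convert this using 1
      rw [pow_succ, ← mul_assoc, mul_comm Polynomial.X (Polynomial.C a * Polynomial.X ^ n)]
      abel

lemma charMap_exact : Function.Exact (charMap R M) (charEval R M) := by
  intro t
  constructor
  · intro h
    have := sub_charEval_mem_range t
    rw [h, TensorProduct.tmul_zero, sub_zero] at this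
    exact this
  · rintro ⟨t, rfl⟩
    induction t with
    | zero => simp
    | add x y hx hy => rw [map_add, map_add, hx, hy, add_zero]
    | tmul p m => rw [charMap_tmul, map_sub, charEval_tmul, charEval_tmul, smul_smul, mul_comm,
        sub_self]

lemma charMap_injective : Function.Injective (charMap R M) := by
  rw [injective_iff_map_eq_zero]
  intro t ht
  let e := PolynomialModule.polynomialTensorProductLEquivPolynomialModule (R := R) (M := M)
  have he : ∀ (p : R[X]) (m : M), e (p ⊗ₜ m) = p • PolynomialModule.single R 0 m := by
    intro p m
    change LinearMap.liftBaseChange R[X] (PolynomialModule.lsingle R (M := M) 0) (p ⊗ₜ m) = _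
    simp [PolynomialModule.lsingle]
  have h1 : ∀ t n, (e ((mulVar R M).baseChange R[X] t)).coeff n =
      (Polynomial.X : R[X]) • (e t).coeff n := by
    intro t n
    induction t with
    | zero => simp
    | add x y hx hy => simp [hx, hy]
    | tmul p m =>
      rw [LinearMap.baseChange_tmul, he, he, PolynomialModule.smul_single_apply,
        PolynomialModule.smul_single_apply]
      simpa [mulVar] using (smul_algebra_smul_comm (p.coeff n) (Polynomial.X : R[X]) m).symm
  have h2 : ∀ n, (e t).coeff n = (Polynomial.X : R[X]) • (e t).coeff (n + 1) := by
    intro n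
    have : (Polynomial.X : R[X]) • t = (mulVar R M).baseChange R[X] t := by
      simpa [charMap, sub_eq_zero] using ht
    rw [← h1, ← this, map_smul, ← Polynomial.monomial_one_one_eq_X,
      PolynomialModule.monomial_smul_apply]
    simp
  have h3 : ∀ k n, (e t).coeff (n + k) = 0 → (e t).coeff n = 0 := by
    intro k
    induction k with
    | zero => intro n h; exact h
    | succ k ih =>
      intro n h
      apply ih
      rw [h2, add_assoc, h, smul_zero]
  have h4 : e t = 0 := by
    rw [← PolynomialModule.coeff_eq_zero]
    ext n
    obtain ⟨N, hN⟩ := (e t).coeff.support.finite_toSet.bddAbove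
    refine h3 (N + 1) n ?_
    by_contra h
    have := hN (Finsupp.mem_support_iff.2 h)
    omega
  exact (LinearEquiv.map_eq_zero_iff e).1 h4

lemma GlobalDimLE.polynomial {n : ℕ} (h : GlobalDimLE R n) : GlobalDimLE R[X] (n + 1) := by
  intro M _ _
  let : Module R M := Module.compHom M (Polynomial.C : R →+* R[X])
  have : IsScalarTower R R[X] M := IsScalarTower.of_algebraMap_smul fun r m => rfl
  have h1 : pdLE R[X] n (R[X] ⊗[R] M) := (h M).baseChange R[X]
  refine pdLE_right (f := charMap R M) (g := charEval R M) charMap_injective charMap_exact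
    (fun m => ⟨1 ⊗ₜ m, by rw [charEval_tmul, one_smul]⟩) h1 (pdLE_mono (Nat.le_succ n) h1)

/-- Hilbert's syzygy theorem. -/
theorem globalDimLE_mvPolynomial (K : Type) [Field K] (n : ℕ) :
    GlobalDimLE (MvPolynomial (Fin n) K) n := by
  induction n with
  | zero =>
    refine GlobalDimLE.of_ringEquiv (MvPolynomial.isEmptyRingEquiv K (Fin 0)).symm ?_
    intro M _ _
    exact (inferInstance : Module.Projective K M)
  | succ n ih =>
    exact GlobalDimLE.of_ringEquiv (MvPolynomial.finSuccEquiv K n).symm.toRingEquiv ih.polynomial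

end Syzygy

section ChangeOfRings

open scoped TensorProduct

variable {S R : Type} [CommRing S] [CommRing R]

lemma exact_finsupp_mul [Algebra S R] (α : S)
    (hker : RingHom.ker (algebraMap S R) = Ideal.span {α}) (ι : Type) (x : ι →₀ S) :
    Finsupp.mapRange.linearMap (Algebra.linearMap S R) x = 0 ↔ ∃ y : ι →₀ S, α • y = x := by
  constructor
  · intro h
    have h1 : ∀ i, ∃ b, α * b = x i := by
      intro i
      have : x i ∈ RingHom.ker (algebraMap S R) := by
        have := DFunLike.congr_fun h i
        simpa using this
      rw [hker, Ideal.mem_span_singleton'] at this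
      obtain ⟨b, hb⟩ := this
      exact ⟨b, by rw [mul_comm, hb]⟩
    choose b hb using h1
    refine ⟨Finsupp.onFinset x.support (fun i => if x i = 0 then 0 else b i) ?_, ?_⟩
    · intro i hi
      simp only [ne_eq, ite_eq_left_iff, Classical.not_imp] at hi
      exact Finsupp.mem_support_iff.2 hi.1
    · ext i
      by_cases hi : x i = 0 <;> simp [hi, hb]
  · rintro ⟨y, rfl⟩
    have : algebraMap S R α = 0 := by
      rw [← RingHom.mem_ker, hker]
      exact Ideal.mem_span_singleton_self α
    ext i
    simp [Algebra.smul_def, this]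

lemma pdLE_one_finsupp [Algebra S R] (hsurj : Function.Surjective (algebraMap S R)) (α : S)
    (hα : IsLeftRegular α) (hker : RingHom.ker (algebraMap S R) = Ideal.span {α}) (ι : Type) :
    pdLE S 1 (ι →₀ R) := by
  refine pdLE_right (f := LinearMap.lsmul S (ι →₀ S) α)
    (g := Finsupp.mapRange.linearMap (Algebra.linearMap S R)) ?_ ?_ ?_
    (pdLE_of_projective 0) (pdLE_of_projective 1)
  · intro x y h
    ext i
    exact hα (DFunLike.congr_fun h i)
  · intro x
    rw [exact_finsupp_mul α hker]
    rfl
  · exact Finsupp.mapRange_surjective _ (by simp) hsurj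

lemma exists_smul_of_one_tmul_eq_zero [Algebra S R]
    (hsurj : Function.Surjective (algebraMap S R)) (α : S)
    (hker : RingHom.ker (algebraMap S R) = Ideal.span {α})
    {P : Type} [AddCommGroup P] [Module S P] (x : P) (hx : (1 : R) ⊗ₜ[S] x = 0) :
    ∃ y : P, α • y = x := by
  have h1 : Function.Exact (LinearMap.lsmul S S α) (Algebra.linearMap S R) := by
    intro s
    rw [Algebra.linearMap_apply, ← RingHom.mem_ker, hker, Ideal.mem_span_singleton']
    simp [mul_comm]
  have h2 := rTensor_exact P h1 hsurj
  obtain ⟨t, ht⟩ := (h2 (1 ⊗ₜ x)).1 (by simpa using hx)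
  refine ⟨TensorProduct.lid S P t, ?_⟩
  have h3 : ∀ t : S ⊗[S] P, TensorProduct.lid S P ((LinearMap.lsmul S S α).rTensor P t) =
      α • TensorProduct.lid S P t := by
    intro t
    induction t with
    | zero => simp
    | add a b ha hb => simp [ha, hb]
    | tmul a b => simp [mul_smul]
  rw [← h3, ht]
  simp

lemma one_tmul_surjective [Algebra S R]
    (hsurj : Function.Surjective (algebraMap S R))
    {P : Type} [AddCommGroup P] [Module S P] (t : R ⊗[S] P) :
    ∃ x : P, (1 : R) ⊗ₜ[S] x = t := by
  induction t with
  | zero => exact ⟨0, by simp⟩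
  | add a b ha hb =>
    obtain ⟨x, rfl⟩ := ha
    obtain ⟨y, rfl⟩ := hb
    exact ⟨x + y, TensorProduct.tmul_add _ _ _⟩
  | tmul r x =>
    obtain ⟨s, rfl⟩ := hsurj r
    exact ⟨s • x, by rw [← TensorProduct.smul_tmul, Algebra.algebraMap_eq_smul_one]⟩

/-- A module over a hypersurface ring `R = S / α` of finite projective dimension over `R` which
has projective dimension at most one over `S` is projective over `R`. -/
lemma projective_of_pdLE_one [Algebra S R] (hsurj : Function.Surjective (algebraMap S R)) (α : S)
    (hα : IsLeftRegular α) (hker : RingHom.ker (algebraMap S R) = Ideal.span {α})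
    {d : ℕ} (M : Type) [AddCommGroup M] [Module R M] [Module S M] [IsScalarTower S R M]
    (hd : pdLE R d M) (hM : pdLE S 1 M) : pdLE R 0 M := by
  obtain ⟨ι, f, hf, hP⟩ := hM
  have : Module.Projective S (LinearMap.ker f) := hP
  have hα0 : ∀ m : M, α • m = 0 := by
    intro m
    have : algebraMap S R α = 0 := by
      rw [← RingHom.mem_ker, hker]
      exact Ideal.mem_span_singleton_self α
    rw [← algebraMap_smul R, this, zero_smul]
  let π : (ι →₀ S) →ₗ[S] (ι →₀ R) := Finsupp.mapRange.linearMap (Algebra.linearMap S R)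
  have hπ : Function.Surjective π := Finsupp.mapRange_surjective _ (by simp) hsurj
  let fb : (ι →₀ R) →ₗ[R] M := Finsupp.linearCombination R fun i => f (Finsupp.single i 1)
  have hfb : ∀ x, fb (π x) = f x := by
    intro x
    induction x using Finsupp.induction_linear with
    | zero => simp
    | add x y hx hy => simp [hx, hy]
    | single i s =>
      have : Finsupp.single i s = s • Finsupp.single i (1 : S) := by simp
      simp only [π, fb, Finsupp.mapRange.linearMap_apply, Finsupp.mapRange_single,
        Finsupp.linearCombination_single, Algebra.linearMap_apply]
      rw [this, map_smul, algebraMap_smul]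
  have hfbs : Function.Surjective fb := fun m => by
    obtain ⟨x, rfl⟩ := hf m
    exact ⟨π x, hfb x⟩
  let u : LinearMap.ker f →ₗ[S] LinearMap.ker fb :=
    { toFun := fun x => ⟨π x, by rw [LinearMap.mem_ker, hfb]; exact x.2⟩
      map_add' := fun x y => by ext; simp
      map_smul' := fun s x => by
        ext i
        simp [Algebra.smul_def] }
  let h : R ⊗[S] LinearMap.ker f →ₗ[R] LinearMap.ker fb := LinearMap.liftBaseChange R u
  have hh : ∀ x, h (1 ⊗ₜ x) = u x := fun x => by simp [h]
  have hhs : Function.Surjective h := by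
    rintro ⟨y, hy⟩
    obtain ⟨x, rfl⟩ := hπ y
    rw [LinearMap.mem_ker, hfb] at hy
    exact ⟨1 ⊗ₜ ⟨x, hy⟩, hh _⟩
  have hker' : ∀ x : ι →₀ S, α • x ∈ LinearMap.ker f := fun x => by
    rw [LinearMap.mem_ker, map_smul, hα0]
  let j : (ι →₀ S) →ₗ[S] R ⊗[S] LinearMap.ker f :=
    (TensorProduct.mk S R (LinearMap.ker f) 1) ∘ₗ
      (LinearMap.codRestrict (LinearMap.ker f) (LinearMap.lsmul S (ι →₀ S) α) hker')
  have hj : ∀ x, j x = 1 ⊗ₜ ⟨α • x, hker' x⟩ := fun x => rfl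
  have hαt : ∀ x : LinearMap.ker f, (1 : R) ⊗ₜ[S] (α • x) = 0 := fun x => by
    rw [TensorProduct.tmul_smul, TensorProduct.smul_tmul', ← Algebra.algebraMap_eq_smul_one,
      (show algebraMap S R α = 0 by
        rw [← RingHom.mem_ker, hker]
        exact Ideal.mem_span_singleton_self α), TensorProduct.zero_tmul]
  have hjk : ∀ x, j x = 0 ↔ f x = 0 := by
    intro x
    rw [hj]
    constructor
    · intro h0
      obtain ⟨y, hy⟩ := exists_smul_of_one_tmul_eq_zero (P := LinearMap.ker f)
        hsurj α hker _ h0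
      have : x = y := by
        ext i
        refine hα ?_
        exact (DFunLike.congr_fun (congrArg Subtype.val hy) i).symm
      rw [this]
      exact y.2
    · intro hx
      exact hαt ⟨x, hx⟩
  choose sec hsec using hf
  have hj2 : ∀ x y, f x = f y → j x = j y := fun x y hxy => by
    rw [← sub_eq_zero, ← map_sub, hjk, map_sub, hxy, sub_self]
  let i : M →ₗ[R] R ⊗[S] LinearMap.ker f :=
    { toFun := fun m => j (sec m)
      map_add' := fun a b => by
        rw [← map_add]
        exact hj2 _ _ (by simp [hsec])
      map_smul' := fun r m => by
        obtain ⟨s, rfl⟩ := hsurj r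
        rw [RingHom.id_apply, algebraMap_smul, algebraMap_smul, ← map_smul]
        exact hj2 _ _ (by simp [hsec]) }
  have hii : Function.Injective i := by
    rw [injective_iff_map_eq_zero]
    intro m hm
    have := (hjk _).1 hm
    rwa [hsec] at this
  have hih : Function.Exact i h := by
    intro t
    obtain ⟨x, rfl⟩ := one_tmul_surjective (P := LinearMap.ker f) hsurj t
    rw [hh]
    constructor
    · intro h0
      obtain ⟨y, hy⟩ := (exact_finsupp_mul α hker ι x.1).1 (congrArg Subtype.val h0)
      refine ⟨f y, ?_⟩
      change j (sec (f y)) = _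
      rw [hj2 _ y (hsec _), hj]
      congr 1
      exact Subtype.ext hy
    · rintro ⟨m, hm⟩
      rw [← hh, ← hm]
      change h (j (sec m)) = 0
      rw [hj, hh]
      ext1
      exact (exact_finsupp_mul α hker ι _).2 ⟨_, rfl⟩
  induction d with
  | zero => exact hd
  | succ d ih =>
    refine ih ?_
    have h1 : pdLE R d (LinearMap.ker fb) := pdLE_ker hfbs (pdLE_of_projective _) hd
    exact pdLE_left hii hih hhs (pdLE_of_projective _) (pdLE_mono (Nat.le_succ d) h1)

lemma pdLE_of_pdLE_succ [Algebra S R] (hsurj : Function.Surjective (algebraMap S R)) (α : S)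
    (hα : IsLeftRegular α) (hker : RingHom.ker (algebraMap S R) = Ideal.span {α})
    {d : ℕ} (hd : GlobalDimLE R d) (p : ℕ)
    (M : Type) [AddCommGroup M] [Module R M] [Module S M] [IsScalarTower S R M]
    (hM : pdLE S (p + 1) M) : pdLE R p M := by
  induction p generalizing M with
  | zero => exact projective_of_pdLE_one hsurj α hα hker M (hd M) hM
  | succ p ih =>
    have hs := Finsupp.linearCombination_id_surjective R M
    refine pdLE_of_surjective hs (pdLE_of_projective _) (ih _ ?_)
    exact pdLE_ker (g := (Finsupp.linearCombination R (id : M → M)).restrictScalars S) hs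
      (pdLE_mono (by omega) (pdLE_one_finsupp hsurj α hα hker M)) hM

/-- Projective dimension of a quotient over a hypersurface ring. -/
theorem pdLE_of_semilinear_surjective {ρ : S →+* R} (hρ : Function.Surjective ρ) {α : S}
    (hα : IsLeftRegular α) (hker : RingHom.ker ρ = Ideal.span {α})
    {d : ℕ} (hd : GlobalDimLE R d) {p : ℕ} {N M : Type} [AddCommGroup N] [Module S N]
    [AddCommGroup M] [Module R M] {g : N →ₛₗ[ρ] M} (hg : Function.Surjective g)
    (hN : pdLE S p N) (hk : pdLE S p (LinearMap.ker g)) : pdLE R p M := by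
  let : Algebra S R := ρ.toAlgebra
  let : Module S M := Module.compHom M ρ
  have : IsScalarTower S R M := IsScalarTower.of_algebraMap_smul fun r m => rfl
  let g' : N →ₗ[S] M :=
    { toFun := g
      map_add' := map_add g
      map_smul' := fun s x => g.map_smulₛₗ s x }
  refine pdLE_of_pdLE_succ (S := S) hρ α hα hker hd p M ?_
  exact pdLE_of_surjective (g := g') hg (pdLE_mono (Nat.le_succ p) hN) hk

end ChangeOfRings

section Depth

open CategoryTheory Abelian RingTheory.Sequence Pointwise
open scoped TensorProduct

lemma isWeaklyRegular_X (K : Type) [Field K] (ℓ : ℕ) :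
    IsWeaklyRegular (PS K ℓ) (List.ofFn (X : Fin ℓ → PS K ℓ)) := by
  refine ⟨fun i hi => ?_⟩
  have hi' : i < ℓ := by simpa using hi
  have hid : (Ideal.ofList ((List.ofFn (X : Fin ℓ → PS K ℓ)).take i) • ⊤ : Ideal (PS K ℓ)) =
      Ideal.span (X '' {j : Fin ℓ | (j : ℕ) < i}) := by
    rw [smul_eq_mul, Ideal.mul_top, Ideal.ofList]
    congr 1
    ext p
    simp only [List.mem_take_iff_getElem, List.getElem_ofFn, Set.mem_ofPred_eq, Set.mem_image]
    constructor
    · rintro ⟨j, hj, rfl⟩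
      exact ⟨⟨j, by simp at hj; omega⟩, by simp at hj; simpa using hj.1, rfl⟩
    · rintro ⟨j, hj, rfl⟩
      exact ⟨j, by simpa using hj, rfl⟩
  rw [isSMulRegular_iff_right_eq_zero_of_smul]
  intro q hq
  obtain ⟨f, rfl⟩ := Submodule.Quotient.mk_surjective _ q
  rw [← Submodule.Quotient.mk_smul, Submodule.Quotient.mk_eq_zero] at hq
  rw [Submodule.Quotient.mk_eq_zero]
  rw [hid, mem_ideal_span_X_image] at hq ⊢
  intro m hm
  rw [List.getElem_ofFn, smul_eq_mul] at hq
  obtain ⟨j, hj, hj'⟩ := hq (Finsupp.single ⟨i, hi'⟩ 1 + m) (by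
    rw [mem_support_iff] at hm ⊢
    rwa [coeff_X_mul])
  refine ⟨j, hj, ?_⟩
  have hne : (⟨i, hi'⟩ : Fin ℓ) ≠ j := by
    rintro rfl
    simp at hj
  simpa [Finsupp.single_apply, hne] using hj'

lemma subsingleton_ext_of_isWeaklyRegular {R : Type} [CommRing R] (E M : ModuleCat.{0} R)
    (rs : List R) (mem : ∀ r ∈ rs, r ∈ Module.annihilator R E) (reg : IsWeaklyRegular M rs)
    (i : ℕ) (hi : i < rs.length) : Subsingleton (Ext E M i) := by
  induction rs generalizing M i with
  | nil => simp at hi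
  | cons a rs ih =>
    rw [isWeaklyRegular_cons_iff] at reg
    have ha := mem a List.mem_cons_self
    match i with
    | 0 =>
      have : Subsingleton (E →ₗ[R] M) := by
        refine ⟨fun f g => LinearMap.ext fun x => reg.1 ?_⟩
        change a • f x = a • g x
        rw [← map_smul, ← map_smul, Module.mem_annihilator.1 ha, map_zero, map_zero]
      exact (Ext.addEquiv₀.trans ModuleCat.homAddEquiv).subsingleton
    | i + 1 =>
      let g := (AddCommGrpCat.ofHom ((Ext.mk₀ (ModuleCat.smulShortComplex M a).f).postcomp E
        (add_zero (i + 1))))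
      have mono_g : Mono g := by
        apply (Ext.covariant_sequence_exact₁' E reg.1.smulShortComplex_shortExact i (i + 1)
          rfl).mono_g ((AddCommGrpCat.isZero_of_iff_subsingleton.mpr ?_).eq_zero_of_src _)
        exact ih (ModuleCat.of R (QuotSMulTop a M)) (fun r hr => mem r (List.mem_cons_of_mem _ hr))
          reg.2 i (by simpa using hi)
      have zero_g : g = 0 := Ext.postcomp_smul_id_eq_zero_of_mem_annihilator ha (i + 1)
      exact AddCommGrpCat.subsingleton_of_isZero (Limits.IsZero.of_mono_eq_zero _ zero_g)

lemma isWeaklyRegular_X_of_flat (P : Type) [AddCommGroup P] [Module (PS K ℓ) P]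
    [Module.Flat (PS K ℓ) P] : IsWeaklyRegular P (List.ofFn (X : Fin ℓ → PS K ℓ)) :=
  ((TensorProduct.rid (PS K ℓ) P).isWeaklyRegular_congr _).1
    ((isWeaklyRegular_X K ℓ).isWeaklyRegular_lTensor (M₂ := P))

lemma subsingleton_ext_of_shortExact₃ {R : Type} [CommRing R] (E : ModuleCat.{0} R)
    {T : ShortComplex (ModuleCat.{0} R)} (hT : T.ShortExact) {i : ℕ}
    (h2 : Subsingleton (Ext E T.X₂ i)) (h1 : Subsingleton (Ext E T.X₁ (i + 1))) :
    Subsingleton (Ext E T.X₃ i) := by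
  refine AddCommGrpCat.subsingleton_of_isZero
    ((Ext.covariant_sequence_exact₃' E hT i (i + 1) rfl).isZero_of_both_zeros ?_ ?_)
  · exact (AddCommGrpCat.isZero_of_iff_subsingleton.mpr h2).eq_zero_of_src _
  · exact (AddCommGrpCat.isZero_of_iff_subsingleton.mpr h1).eq_zero_of_tgt _

/-- A form of the Auslander–Buchsbaum inequality: the module `N` of projective dimension at most
`d` has depth at least `ℓ - d` with respect to the ideal of the variables. -/
lemma subsingleton_ext_of_pdLE (I : Ideal (PS K ℓ)) (hI : ∀ j, X j ∈ I) {d : ℕ}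
    (N : Type) [AddCommGroup N] [Module (PS K ℓ) N] (hN : pdLE (PS K ℓ) d N) (i : ℕ)
    (hi : i + d < ℓ) :
    Subsingleton (Ext (ModuleCat.of (PS K ℓ) (PS K ℓ ⧸ I)) (ModuleCat.of (PS K ℓ) N) i) := by
  have flat : ∀ (P : Type) [AddCommGroup P] [Module (PS K ℓ) P] [Module.Flat (PS K ℓ) P] (i : ℕ),
      i < ℓ →
      Subsingleton (Ext (ModuleCat.of (PS K ℓ) (PS K ℓ ⧸ I)) (ModuleCat.of (PS K ℓ) P) i) := by
    intro P _ _ _ i hi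
    refine subsingleton_ext_of_isWeaklyRegular _ _ (List.ofFn (X : Fin ℓ → PS K ℓ)) ?_
      (isWeaklyRegular_X_of_flat P) i (by simpa using hi)
    intro r hr
    obtain ⟨j, rfl⟩ := (List.mem_ofFn' _ _).1 hr
    change _ ∈ Module.annihilator (PS K ℓ) (PS K ℓ ⧸ I)
    rw [Ideal.annihilator_quotient]
    exact hI j
  induction d generalizing N i with
  | zero =>
    have : Module.Projective (PS K ℓ) N := hN
    exact flat N i (by omega)
  | succ d ih =>
    obtain ⟨ι, f, hf, hk⟩ := hN
    exact subsingleton_ext_of_shortExact₃ _ (LinearMap.shortExact_shortComplexKer hf)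
      (flat (ι →₀ PS K ℓ) i (by omega)) (ih _ hk (i + 1) (by omega))

/-- An element which multiplies into the image of `g` by all variables lies in the image, if the
source and the kernel of `g` have small projective dimension. -/
theorem mem_range_of_forall_smul_mem_range {R : Type} [CommRing R] {ρ : PS K ℓ →+* R}
    [RingHomSurjective ρ]
    (I : Ideal (PS K ℓ)) (hI : ∀ j, X j ∈ I) {p : ℕ} (hp : p + 3 ≤ ℓ) {N M : Type}
    [AddCommGroup N] [Module (PS K ℓ) N] [AddCommGroup M] [Module R M] {g : N →ₛₗ[ρ] M}
    (hN : pdLE (PS K ℓ) p N) (hk : pdLE (PS K ℓ) p (LinearMap.ker g))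
    (hM : ∀ m : M, (∀ s ∈ I, ρ s • m = 0) → m = 0) (ω : M)
    (hω : ∀ s ∈ I, ρ s • ω ∈ LinearMap.range g) : ω ∈ LinearMap.range g := by
  let : Module (PS K ℓ) M := Module.compHom M ρ
  have hsmul : ∀ (s : PS K ℓ) (m : M), s • m = ρ s • m := fun s m => rfl
  let g' : N →ₗ[PS K ℓ] M :=
    { toFun := g
      map_add' := map_add g
      map_smul' := fun s x => g.map_smulₛₗ s x }
  have hE1 := subsingleton_ext_of_pdLE I hI N hN 1 (by omega)
  have hE2 := subsingleton_ext_of_pdLE I hI (LinearMap.ker g) hk 2 (by omega)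
  have hE3 : Subsingleton (Ext (ModuleCat.of (PS K ℓ) (PS K ℓ ⧸ I))
      (ModuleCat.of (PS K ℓ) (LinearMap.range g')) 1) :=
    subsingleton_ext_of_shortExact₃ _ (shortExact_of_exact
      (f := (LinearMap.ker g).subtype) (g := g'.rangeRestrict)
      (LinearMap.ker g).injective_subtype (fun x => by
        rw [← LinearMap.mem_ker, LinearMap.ker_rangeRestrict]
        exact ⟨fun h => ⟨⟨x, h⟩, rfl⟩, fun ⟨y, hy⟩ => hy ▸ y.2⟩)
      g'.surjective_rangeRestrict) hE1 hE2
  have hE4 : Subsingleton (Ext (ModuleCat.of (PS K ℓ) (PS K ℓ ⧸ I))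
      (ModuleCat.of (PS K ℓ) M) 0) := by
    have : Subsingleton ((PS K ℓ ⧸ I) →ₗ[PS K ℓ] M) := by
      refine ⟨fun f h => LinearMap.ext fun x => sub_eq_zero.1 (hM _ fun s hs => ?_)⟩
      rw [← hsmul, smul_sub, ← map_smul, ← map_smul]
      have : s • x = 0 := by
        have : s ∈ Module.annihilator (PS K ℓ) (PS K ℓ ⧸ I) := by
          rwa [Ideal.annihilator_quotient]
        exact Module.mem_annihilator.1 this x
      rw [this, map_zero, map_zero, sub_self]
    exact (Ext.addEquiv₀.trans ModuleCat.homAddEquiv).subsingleton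
  have hE5 : Subsingleton (Ext (ModuleCat.of (PS K ℓ) (PS K ℓ ⧸ I))
      (ModuleCat.of (PS K ℓ) (M ⧸ LinearMap.range g')) 0) :=
    subsingleton_ext_of_shortExact₃ _ (shortExact_of_exact
      (f := (LinearMap.range g').subtype) (g := (LinearMap.range g').mkQ)
      (LinearMap.range g').injective_subtype (LinearMap.exact_subtype_mkQ _)
      (Submodule.mkQ_surjective _)) hE4 hE3
  have hE6 : Subsingleton ((PS K ℓ ⧸ I) →ₗ[PS K ℓ] (M ⧸ LinearMap.range g')) :=
    ((Ext.addEquiv₀ (X := ModuleCat.of (PS K ℓ) (PS K ℓ ⧸ I))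
      (Y := ModuleCat.of (PS K ℓ) (M ⧸ LinearMap.range g'))).trans
      ModuleCat.homAddEquiv).symm.subsingleton
  let φ : (PS K ℓ ⧸ I) →ₗ[PS K ℓ] (M ⧸ LinearMap.range g') :=
    Submodule.liftQ I (LinearMap.toSpanSingleton (PS K ℓ) _ ((LinearMap.range g').mkQ ω)) (by
      intro s hs
      rw [LinearMap.mem_ker, LinearMap.toSpanSingleton_apply, ← map_smul, ← LinearMap.mem_ker,
        Submodule.ker_mkQ]
      exact hω s hs)
  have h1 : φ (Submodule.Quotient.mk 1) = 0 := by
    rw [Subsingleton.elim φ 0]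
    rfl
  rw [show φ (Submodule.Quotient.mk 1) = (LinearMap.range g').mkQ ω from by
      change LinearMap.toSpanSingleton (PS K ℓ) (M ⧸ LinearMap.range g')
        ((LinearMap.range g').mkQ ω) 1 = _
      rw [LinearMap.toSpanSingleton_apply, one_smul],
    ← LinearMap.mem_ker, Submodule.ker_mkQ] at h1
  exact h1

/-- If `g` is not surjective, then its cokernel has an associated prime. -/
theorem exists_isPrime_of_not_surjective {S R : Type} [CommRing S] [IsNoetherianRing S]
    [CommRing R] {ρ : S →+* R} [RingHomSurjective ρ] {N M : Type}
    [AddCommGroup N] [Module S N] [AddCommGroup M] [Module R M] {g : N →ₛₗ[ρ] M}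
    (hg : ¬ Function.Surjective g) :
    ∃ (P : Ideal S) (ω : M), P.IsPrime ∧ ω ∉ LinearMap.range g ∧
      ∀ s, s ∈ P ↔ ρ s • ω ∈ LinearMap.range g := by
  let : Module S M := Module.compHom M ρ
  let g' : N →ₗ[S] M :=
    { toFun := g
      map_add' := map_add g
      map_smul' := fun s x => g.map_smulₛₗ s x }
  have hnt : Nontrivial (M ⧸ LinearMap.range g') := by
    rw [Submodule.Quotient.nontrivial_iff]
    exact fun h => hg (LinearMap.range_eq_top (f := g').1 h)
  obtain ⟨P, hP⟩ := associatedPrimes.nonempty S (M ⧸ LinearMap.range g')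
  obtain ⟨hP1, x, hx⟩ := isAssociatedPrime_iff.1 (AssociatedPrimes.mem_iff.1 hP)
  obtain ⟨ω, rfl⟩ := Submodule.Quotient.mk_surjective _ x
  have key : ∀ s, s ∈ P ↔ ρ s • ω ∈ LinearMap.range g := by
    intro s
    rw [hx, Submodule.mem_colon_singleton, Submodule.mem_bot, ← Submodule.Quotient.mk_smul,
      Submodule.Quotient.mk_eq_zero]
    rfl
  refine ⟨P, ω, hP1, ?_, key⟩
  intro h
  refine hP1.ne_top ((Ideal.eq_top_iff_one _).2 ((key 1).2 ?_))
  rwa [map_one, one_smul]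

end Depth

section LinearForms

variable {n k : ℕ}

/-- The pullback of (coefficient vectors of) linear forms along a linear map. -/
def pullForm (e : (Fin n → K) →ₗ[K] (Fin ℓ → K)) : (Fin ℓ → K) →ₗ[K] (Fin n → K) where
  toFun c i := c ⬝ᵥ e (Pi.single i 1)
  map_add' a b := by ext i; simp [add_dotProduct]
  map_smul' t a := by ext i; simp [smul_dotProduct]

lemma pullForm_dotProduct (e : (Fin n → K) →ₗ[K] (Fin ℓ → K)) (c : Fin ℓ → K) (w : Fin n → K) :
    pullForm e c ⬝ᵥ w = c ⬝ᵥ e w := by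
  conv_rhs => rw [← Finset.univ_sum_single w]
  simp only [dotProduct, map_sum, Finset.sum_apply, Finset.mul_sum]
  rw [Finset.sum_comm]
  refine Finset.sum_congr rfl fun i _ => ?_
  have : Pi.single i (w i) = w i • (Pi.single i 1 : Fin n → K) := by
    rw [← Pi.single_smul]; simp
  rw [this, map_smul]
  simp only [pullForm, dotProduct, LinearMap.coe_mk, AddHom.coe_mk, Pi.smul_apply, smul_eq_mul,
    Finset.sum_mul]
  exact Finset.sum_congr rfl fun j _ => by ring

lemma eq_pullForm_iff {e : (Fin n → K) →ₗ[K] (Fin ℓ → K)} {c : Fin ℓ → K} {b : Fin n → K} :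
    pullForm e c = b ↔ ∀ w, c ⬝ᵥ e w = b ⬝ᵥ w := by
  simp only [← pullForm_dotProduct]
  exact ⟨fun h w => by rw [h], fun h => dotProduct_eq _ _ h⟩

lemma pullForm_comp (f : (Fin k → K) →ₗ[K] (Fin n → K)) (e : (Fin n → K) →ₗ[K] (Fin ℓ → K))
    (c : Fin ℓ → K) : pullForm (e ∘ₗ f) c = pullForm f (pullForm e c) := by
  rw [eq_pullForm_iff]
  intro w
  rw [pullForm_dotProduct, pullForm_dotProduct]
  rfl

lemma pullForm_id (c : Fin ℓ → K) : pullForm LinearMap.id c = c := by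
  rw [eq_pullForm_iff]
  intro w
  rfl

lemma linP_add (a b : Fin ℓ → K) : linP (a + b) = linP a + linP b := by
  simp [linP, add_mul, Finset.sum_add_distrib]

lemma linP_smul (t : K) (a : Fin ℓ → K) : linP (t • a) = C t * linP a := by
  simp [linP, Finset.mul_sum, mul_assoc]

lemma linP_zero : linP (0 : Fin ℓ → K) = 0 := by simp [linP]

lemma linP_sub (a b : Fin ℓ → K) : linP (a - b) = linP a - linP b := by
  simp [linP, sub_mul, Finset.sum_sub_distrib]

lemma linP_single (i : Fin ℓ) : linP (Pi.single i (1 : K)) = X i := by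
  unfold linP
  rw [Finset.sum_eq_single i] <;> simp +contextual

lemma coeff_linP (c : Fin ℓ → K) (i : Fin ℓ) : coeff (Finsupp.single i 1) (linP c) = c i := by
  unfold linP
  rw [coeff_sum, Finset.sum_eq_single i]
  · simp [coeff_C_mul]
  · intro j _ hj
    rw [coeff_C_mul, coeff_X, if_neg, mul_zero]
    simpa [Finsupp.single_left_inj] using hj
  · simp

lemma linP_injective : Function.Injective (linP : (Fin ℓ → K) → PS K ℓ) := fun a b h => by
  ext i; rw [← coeff_linP a, h, coeff_linP]

lemma linP_ne_zero {c : Fin ℓ → K} (hc : c ≠ 0) : linP c ≠ 0 := fun h =>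
  hc (linP_injective (h.trans linP_zero.symm))

lemma dP_add (a b : Fin ℓ → K) : dP (a + b) = dP a + dP b := by
  rw [dP, dP, dP, ← map_add]; congr 1; ext i; simp

lemma dP_smul (t : K) (a : Fin ℓ → K) : dP (t • a) = (C t : PS K ℓ) • dP a := by
  rw [dP, dP, ← map_smul]; congr 1; ext i; simp

lemma dP_zero : dP (0 : Fin ℓ → K) = 0 := by
  rw [dP]; simp only [Pi.zero_apply, map_zero]; exact map_zero _

lemma dP_sub (a b : Fin ℓ → K) : dP (a - b) = dP a - dP b := by
  rw [dP, dP, dP, ← map_sub]; congr 1; ext i; simp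

/-- The pullback of polynomials along a linear map. -/
def pull (e : (Fin n → K) →ₗ[K] (Fin ℓ → K)) : PS K ℓ →+* PS K n :=
  eval₂Hom C (fun j => linP (pullForm e (Pi.single j 1)))

@[simp] lemma pull_C (e : (Fin n → K) →ₗ[K] (Fin ℓ → K)) (t : K) : pull e (C t) = C t := by
  simp [pull]

lemma sum_smul_single (c : Fin ℓ → K) : ∑ i, c i • (Pi.single i 1 : Fin ℓ → K) = c := by
  conv_rhs => rw [← Finset.univ_sum_single c]
  refine Finset.sum_congr rfl fun i _ => ?_
  rw [← Pi.single_smul]; simp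

lemma linP_sum {ι : Type*} (s : Finset ι) (f : ι → Fin ℓ → K) :
    linP (∑ i ∈ s, f i) = ∑ i ∈ s, linP (f i) :=
  map_sum (AddMonoidHom.mk' (linP : (Fin ℓ → K) → PS K ℓ) linP_add) f s

@[simp] lemma pull_linP (e : (Fin n → K) →ₗ[K] (Fin ℓ → K)) (c : Fin ℓ → K) :
    pull e (linP c) = linP (pullForm e c) := by
  conv_rhs => rw [← sum_smul_single c, map_sum, linP_sum]
  simp only [linP, map_sum, map_mul, pull_C]
  refine Finset.sum_congr rfl fun i _ => ?_
  rw [map_smul, ← linP, linP_smul]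
  simp [pull]

lemma pull_X (e : (Fin n → K) →ₗ[K] (Fin ℓ → K)) (j : Fin ℓ) :
    pull e (X j) = linP (pullForm e (Pi.single j 1)) := by simp [pull]

lemma pull_pull (f : (Fin k → K) →ₗ[K] (Fin n → K)) (e : (Fin n → K) →ₗ[K] (Fin ℓ → K))
    (p : PS K ℓ) : pull f (pull e p) = pull (e ∘ₗ f) p := by
  have : (pull f).comp (pull e) = pull (e ∘ₗ f) := by
    refine MvPolynomial.ringHom_ext (fun t => by simp) fun j => ?_
    simp [pull_X, pullForm_comp]
  rw [← this]; rfl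

lemma pull_id (p : PS K ℓ) : pull LinearMap.id p = p := by
  have : pull (LinearMap.id) = RingHom.id (PS K ℓ) := by
    refine MvPolynomial.ringHom_ext (fun t => by simp) fun j => ?_
    simp [pull_X, pullForm_id, linP_single]
  rw [this]; rfl

lemma sub_pull_mem {f : (Fin ℓ → K) →ₗ[K] (Fin ℓ → K)} {I : Ideal (PS K ℓ)}
    (h : ∀ c, linP c - linP (pullForm f c) ∈ I) (p : PS K ℓ) : p - pull f p ∈ I := by
  have : (Ideal.Quotient.mk I) = (Ideal.Quotient.mk I).comp (pull f) := by
    refine MvPolynomial.ringHom_ext (fun t => by simp) fun j => ?_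
    have := h (Pi.single j 1)
    rw [← Ideal.Quotient.eq_zero_iff_mem, map_sub, sub_eq_zero, linP_single] at this
    rw [this, RingHom.comp_apply, pull_X]
  rw [← Ideal.Quotient.eq_zero_iff_mem, map_sub, sub_eq_zero]
  exact congrArg (· p) this

/-- The projection along `v` onto the kernel of the form `c`, when `c(v) = 1`. -/
def projAlong (c v : Fin ℓ → K) : (Fin ℓ → K) →ₗ[K] (Fin ℓ → K) :=
  LinearMap.id - LinearMap.smulRight (dotLin c) v

lemma dotLin_apply (c v : Fin ℓ → K) : dotLin c v = c ⬝ᵥ v := by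
  simp [dotLin, dotProduct, LinearMap.sum_apply]

lemma projAlong_apply (c v u : Fin ℓ → K) : projAlong c v u = u - (c ⬝ᵥ u) • v := by
  simp [projAlong, dotLin_apply]

lemma pullForm_projAlong (c v a : Fin ℓ → K) :
    pullForm (projAlong c v) a = a - (a ⬝ᵥ v) • c := by
  rw [eq_pullForm_iff]
  intro w
  simp only [projAlong_apply, dotProduct_sub, sub_dotProduct, dotProduct_smul, smul_dotProduct,
    smul_eq_mul]
  ring

lemma exists_dotProduct_eq_one {c : Fin ℓ → K} (hc : c ≠ 0) : ∃ v, c ⬝ᵥ v = 1 := by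
  obtain ⟨i, hi⟩ := Function.ne_iff.1 hc
  exact ⟨Pi.single i (c i)⁻¹, by simpa using mul_inv_cancel₀ hi⟩

lemma ker_pull_projAlong {c v : Fin ℓ → K} (h : c ⬝ᵥ v = 1) :
    RingHom.ker (pull (projAlong c v)) = Ideal.span {linP c} := by
  apply le_antisymm
  · intro p hp
    have := sub_pull_mem (f := projAlong c v) (I := Ideal.span {linP c}) (fun a => by
      rw [pullForm_projAlong, ← linP_sub, sub_sub_cancel, linP_smul]
      exact Ideal.mul_mem_left _ _ (Ideal.mem_span_singleton_self _)) p
    rwa [RingHom.mem_ker.1 hp, sub_zero] at this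
  · rw [Ideal.span_singleton_le_iff_mem, RingHom.mem_ker, pull_linP, pullForm_projAlong, h,
      one_smul, sub_self, linP_zero]

lemma prime_linP {c : Fin ℓ → K} (hc : c ≠ 0) : Prime (linP c) := by
  obtain ⟨v, hv⟩ := exists_dotProduct_eq_one hc
  rw [← Ideal.span_singleton_prime (linP_ne_zero hc), ← ker_pull_projAlong hv]
  exact RingHom.ker_isPrime _

lemma linP_dvd_linP {c b : Fin ℓ → K} (hc : c ≠ 0) (h : linP c ∣ linP b) :
    ∃ t : K, b = t • c := by
  obtain ⟨v, hv⟩ := exists_dotProduct_eq_one hc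
  rw [← Ideal.mem_span_singleton, ← ker_pull_projAlong hv, RingHom.mem_ker, pull_linP,
    pullForm_projAlong] at h
  exact ⟨b ⬝ᵥ v, sub_eq_zero.1 (linP_injective (h.trans linP_zero.symm))⟩

lemma isRelPrime_linP {c b : Fin ℓ → K} (hc : c ≠ 0) (h : ∀ t : K, b ≠ t • c) :
    IsRelPrime (linP c) (linP b) :=
  (prime_linP hc).irreducible.isRelPrime_iff_not_dvd.2 fun hd => by
    obtain ⟨t, ht⟩ := linP_dvd_linP hc hd
    exact h t ht

end LinearForms

section FreeModules

variable {R M : Type*} [CommRing R] [AddCommGroup M] [Module R M]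

/-- Divisibility in a free module is checked on coordinates. -/
lemma exists_eq_smul_iff_repr {ι : Type*} (b : Module.Basis ι R M) {a : R} {m : M} :
    (∃ w, m = a • w) ↔ ∀ i, a ∣ b.repr m i := by
  constructor
  · rintro ⟨w, rfl⟩ i
    exact ⟨b.repr w i, by simp⟩
  · intro h
    choose f hf using h
    refine ⟨b.repr.symm (Finsupp.onFinset (b.repr m).support
      (fun i => if i ∈ (b.repr m).support then f i else 0) (by simp +contextual)), ?_⟩
    apply b.repr.injective
    ext i
    by_cases hi : i ∈ (b.repr m).support
    · rw [map_smul, b.repr.apply_symm_apply]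
      simp only [Finsupp.smul_apply, Finsupp.onFinset_apply, hi, if_true, smul_eq_mul]
      exact hf i
    · rw [map_smul, b.repr.apply_symm_apply]
      simp only [Finsupp.smul_apply, Finsupp.onFinset_apply, hi, if_false, smul_zero]
      simpa using hi

variable [DecompositionMonoid R] [Module.Free R M]

lemma exists_eq_smul_of_isRelPrime {a b : R} (h : IsRelPrime a b) {u v : M}
    (huv : b • u = a • v) : ∃ w, u = a • w := by
  rw [exists_eq_smul_iff_repr (Module.Free.chooseBasis R M)]
  intro i
  refine h.dvd_of_dvd_mul_left ⟨(Module.Free.chooseBasis R M).repr v i, ?_⟩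
  simpa using congrArg (fun z => (Module.Free.chooseBasis R M).repr z i) huv

lemma exists_eq_prod_smul {ι : Type*} {s : Finset ι} {f : ι → R}
    (hf : (s : Set ι).Pairwise fun i j => IsRelPrime (f i) (f j)) {m : M}
    (h : ∀ i ∈ s, ∃ w, m = f i • w) : ∃ w, m = (∏ i ∈ s, f i) • w := by
  rw [exists_eq_smul_iff_repr (Module.Free.chooseBasis R M)]
  intro j
  refine Finset.prod_dvd_of_isRelPrime hf fun i hi => ?_
  exact (exists_eq_smul_iff_repr (Module.Free.chooseBasis R M)).1 (h i hi) j

end FreeModules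

section Regularity

/-- Three linearly independent linear forms are a regular sequence on a free module. -/
lemma exists_eq_add_of_smul_eq {x y z : Fin ℓ → K} (hy : y ≠ 0) (hz : ∀ t : K, z ≠ t • y)
    (hx : ∀ s t : K, x ≠ s • y + t • z) {M : Type*} [AddCommGroup M] [Module (PS K ℓ) M]
    [Module.Free (PS K ℓ) M] {a b c : M}
    (he : linP x • a = linP y • b + linP z • c) :
    ∃ b' c', a = linP y • b' + linP z • c' := by
  obtain ⟨v, hv⟩ := exists_dotProduct_eq_one hy
  obtain ⟨v', hv'⟩ := exists_dotProduct_eq_one (sub_ne_zero.2 (hz (z ⬝ᵥ v)))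
  set z' := z - (z ⬝ᵥ v) • y with hz'
  set f := projAlong y v ∘ₗ projAlong z' v' with hf
  have pf : ∀ u, pullForm f u = u - (u ⬝ᵥ v) • y - ((u - (u ⬝ᵥ v) • y) ⬝ᵥ v') • z' := fun u => by
    rw [hf, pullForm_comp, pullForm_projAlong, pullForm_projAlong]
  have fy : pull f (linP y) = 0 := by
    rw [pull_linP, pf, hv, one_smul, sub_self, zero_dotProduct, zero_smul, sub_zero, linP_zero]
  have fz : pull f (linP z) = 0 := by
    rw [pull_linP, pf, ← hz', hv', one_smul, sub_self, linP_zero]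
  have fx : pull f (linP x) ≠ 0 := by
    rw [pull_linP]
    refine linP_ne_zero fun h => ?_
    rw [pf, sub_sub, sub_eq_zero] at h
    set s := (x - (x ⬝ᵥ v) • y) ⬝ᵥ v'
    refine hx (x ⬝ᵥ v - s * (z ⬝ᵥ v)) s (h.trans ?_)
    rw [hz']
    module
  have hI : ∀ p, p - pull f p ∈ Ideal.span {linP y, linP z} := sub_pull_mem fun u => by
    have h2 : linP z' ∈ Ideal.span {linP y, linP z} := by
      rw [hz', linP_sub, linP_smul]
      exact Ideal.sub_mem _ (Ideal.subset_span (by simp))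
        (Ideal.mul_mem_left _ _ (Ideal.subset_span (by simp)))
    rw [pf, ← linP_sub, sub_sub, sub_sub_cancel, linP_add, linP_smul, linP_smul]
    exact Ideal.add_mem _ (Ideal.mul_mem_left _ _ (Ideal.subset_span (by simp)))
      (Ideal.mul_mem_left _ _ h2)
  let B := Module.Free.chooseBasis (PS K ℓ) M
  have hB : ∀ i, ∃ q r, B.repr a i = linP y * q + linP z * r := fun i => by
    have h1 : linP x * B.repr a i = linP y * B.repr b i + linP z * B.repr c i := by
      simpa using congrArg (fun m => B.repr m i) he
    have h2 : pull f (B.repr a i) = 0 := by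
      have := congrArg (pull f) h1
      rw [map_mul, map_add, map_mul, map_mul, fy, fz, zero_mul, zero_mul, add_zero] at this
      exact (mul_eq_zero.1 this).resolve_left fx
    have h3 := hI (B.repr a i)
    rw [h2, sub_zero, Ideal.mem_span_pair] at h3
    obtain ⟨q, r, h⟩ := h3
    exact ⟨q, r, by rw [← h]; ring⟩
  suffices a ∈ LinearMap.range
      ((LinearMap.lsmul (PS K ℓ) M (linP y)).coprod (LinearMap.lsmul (PS K ℓ) M (linP z))) by
    obtain ⟨⟨b', c'⟩, h⟩ := this
    exact ⟨b', c', h.symm⟩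
  rw [← B.linearCombination_repr a, Finsupp.linearCombination_apply]
  refine Submodule.sum_mem _ fun i _ => ?_
  obtain ⟨q, r, h⟩ := hB i
  exact ⟨(q • B i, r • B i), by simp [h, add_smul, smul_smul, mul_comm]⟩

end Regularity

section ExteriorFree

variable {R M : Type*} [CommRing R] [AddCommGroup M] [Module R M]

lemma free_exteriorAlgebra (R M : Type*) [CommRing R] [AddCommGroup M] [Module R M]
    [Module.Free R M] : Module.Free R (ExteriorAlgebra R M) := by
  let : LinearOrder (Module.Free.ChooseBasisIndex R M) := IsWellOrder.linearOrder WellOrderingRel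
  exact Module.Free.of_basis (Module.Free.chooseBasis R M).ExteriorAlgebra

instance : Module.Free (PS K ℓ) (ExtF K ℓ) := free_exteriorAlgebra _ _

/-- The projection of the exterior algebra onto its component of degree `p`. -/
def degProj (R M : Type*) [CommRing R] [AddCommGroup M] [Module R M] (p : ℕ) :
    ExteriorAlgebra R M →ₗ[R] ExteriorAlgebra R M :=
  GradedAlgebra.proj (fun i => ⋀[R]^i M) p

lemma degProj_mem (p : ℕ) (x : ExteriorAlgebra R M) : degProj R M p x ∈ ⋀[R]^p M := by
  rw [degProj, GradedAlgebra.proj_apply]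
  exact SetLike.coe_mem _

lemma degProj_of_mem {p : ℕ} {x : ExteriorAlgebra R M} (h : x ∈ ⋀[R]^p M) :
    degProj R M p x = x := by
  rw [degProj, GradedAlgebra.proj_apply]
  exact DirectSum.decompose_of_mem_same _ h

lemma degProj_ι_mul (p : ℕ) (m : M) (x : ExteriorAlgebra R M) :
    degProj R M (p + 1) (ExteriorAlgebra.ι R m * x) =
      ExteriorAlgebra.ι R m * degProj R M p x := by
  have hm : ExteriorAlgebra.ι R m ∈ ⋀[R]^1 M := by
    rw [ExteriorAlgebra.exteriorPower, pow_one]; exact ⟨m, rfl⟩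
  rw [degProj, degProj, GradedAlgebra.proj_apply, GradedAlgebra.proj_apply, add_comm]
  exact DirectSum.coe_decompose_mul_add_of_left_mem (fun i => ⋀[R]^i M) hm

end ExteriorFree

section Forms

variable {n k : ℕ}

instance (p : ℕ) : Module.Free (PS K ℓ) (formsP K ℓ p) :=
  inferInstanceAs (Module.Free (PS K ℓ) (⋀[PS K ℓ]^p (Fin ℓ → PS K ℓ)))

lemma degProj_mem_formsP (p : ℕ) (η : ExtF K ℓ) : degProj _ _ p η ∈ formsP K ℓ p :=
  degProj_mem p η

lemma degProj_of_mem_formsP {p : ℕ} {η : ExtF K ℓ} (h : η ∈ formsP K ℓ p) :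
    degProj _ _ p η = η := degProj_of_mem h

lemma degProj_dP_mul (p : ℕ) (c : Fin ℓ → K) (η : ExtF K ℓ) :
    degProj _ _ (p + 1) (dP c * η) = dP c * degProj _ _ p η := degProj_ι_mul p _ η

lemma mem_formsP_of_smul_mem {p : ℕ} {s : PS K ℓ} (hs : s ≠ 0) {η : ExtF K ℓ}
    (h : s • η ∈ formsP K ℓ p) : η ∈ formsP K ℓ p := by
  have := degProj_of_mem_formsP h
  rw [map_smul] at this
  rw [← smul_right_injective _ hs this]
  exact degProj_mem_formsP _ _

lemma dP_mul_dP_self (c : Fin ℓ → K) : dP c * dP c = 0 := ExteriorAlgebra.ι_sq_zero _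

lemma dP_mul_dP_mul (c b : Fin ℓ → K) (x : ExtF K ℓ) :
    dP c * (dP b * x) = - (dP b * (dP c * x)) := by
  rw [← mul_assoc, ← mul_assoc, ← neg_mul]
  congr 1
  exact eq_neg_of_add_eq_zero_left (ExteriorAlgebra.ι_add_mul_swap _ _)

lemma dP_mul_dP_mul_self (c : Fin ℓ → K) (x : ExtF K ℓ) : dP c * (dP c * x) = 0 := by
  rw [← mul_assoc, dP_mul_dP_self, zero_mul]

lemma ι_eq_sum (m : Fin ℓ → PS K ℓ) :
    ExteriorAlgebra.ι (PS K ℓ) m = ∑ i, m i • dP (Pi.single i (1 : K)) := by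
  conv_lhs => rw [← Finset.univ_sum_single m, map_sum]
  refine Finset.sum_congr rfl fun i _ => ?_
  rw [dP, ← map_smul]
  congr 1
  ext j
  by_cases h : j = i
  · subst h; simp
  · simp [h]

/-- Induction on polynomial forms through left multiplication by constant one-forms. -/
lemma dP_induction {P : ExtF K ℓ → Prop} (one : P 1) (add : ∀ x y, P x → P y → P (x + y))
    (smul : ∀ (s : PS K ℓ) x, P x → P (s • x))
    (dmul : ∀ (c : Fin ℓ → K) x, P x → P (dP c * x)) (x : ExtF K ℓ) : P x := by
  induction x using CliffordAlgebra.left_induction with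
  | algebraMap r => rw [Algebra.algebraMap_eq_smul_one]; exact smul r 1 one
  | add x y hx hy => exact add x y hx hy
  | ι_mul x m hx =>
    have h0 : P 0 := by simpa using smul 0 1 one
    change P (ExteriorAlgebra.ι (PS K ℓ) m * x)
    rw [ι_eq_sum, Finset.sum_mul]
    refine Finset.sum_induction _ P add h0 fun i _ => ?_
    rw [smul_mul_assoc]
    exact smul _ _ (dmul _ _ hx)

/-- The linear functional on one-forms given by a constant vector field. -/
def vecDual (v : Fin ℓ → K) : Module.Dual (PS K ℓ) (Fin ℓ → PS K ℓ) :=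
  ∑ i, (C (v i) : PS K ℓ) • (LinearMap.proj i : (Fin ℓ → PS K ℓ) →ₗ[PS K ℓ] PS K ℓ)

/-- Contraction of forms with a constant vector field. -/
def ctr (v : Fin ℓ → K) : ExtF K ℓ →ₗ[PS K ℓ] ExtF K ℓ :=
  CliffordAlgebra.contractLeft (Q := (0 : QuadraticForm (PS K ℓ) (Fin ℓ → PS K ℓ))) (vecDual v)

lemma ctr_dP_mul (v c : Fin ℓ → K) (x : ExtF K ℓ) :
    ctr v (dP c * x) = (C (c ⬝ᵥ v) : PS K ℓ) • x - dP c * ctr v x := by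
  have h : vecDual v (fun i => C (c i)) = C (c ⬝ᵥ v) := by
    simp [vecDual, LinearMap.sum_apply, dotProduct, mul_comm]
  rw [← h]
  exact CliffordAlgebra.contractLeft_ι_mul (vecDual v) _ x

lemma ctr_one (v : Fin ℓ → K) : ctr v 1 = 0 := CliffordAlgebra.contractLeft_one _ (vecDual v)

/-- The forms `η` with `dα ∧ η` divisible by `α`. -/
def LogAt (c : Fin ℓ → K) : Submodule (PS K ℓ) (ExtF K ℓ) :=
  (LinearMap.range (LinearMap.lsmul (PS K ℓ) (ExtF K ℓ) (linP c))).comap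
    (LinearMap.mulLeft (PS K ℓ) (dP c))

lemma mem_LogAt {c : Fin ℓ → K} {η : ExtF K ℓ} :
    η ∈ LogAt c ↔ ∃ ξ, dP c * η = linP c • ξ := by
  simp [LogAt, eq_comm]

lemma mem_LogAt_iff {c : Fin ℓ → K} (hc : c ≠ 0) {η : ExtF K ℓ} :
    η ∈ LogAt c ↔ ∃ a b, η = linP c • a + dP c * b := by
  rw [mem_LogAt]
  constructor
  · rintro ⟨ξ, h⟩
    obtain ⟨v, hv⟩ := exists_dotProduct_eq_one hc
    refine ⟨ctr v ξ, ctr v η, ?_⟩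
    have := congrArg (ctr v) h
    rw [ctr_dP_mul, hv, C_1, one_smul, map_smul] at this
    rw [← this, sub_add_cancel]
  · rintro ⟨a, b, rfl⟩
    exact ⟨dP c * a, by rw [mul_add, dP_mul_dP_mul_self, add_zero, mul_smul_comm]⟩

lemma smul_mem_LogAt (c : Fin ℓ → K) (η : ExtF K ℓ) : linP c • η ∈ LogAt c :=
  mem_LogAt.2 ⟨dP c * η, by rw [mul_smul_comm]⟩

lemma dP_mul_mem_LogAt (c : Fin ℓ → K) (η : ExtF K ℓ) : dP c * η ∈ LogAt c :=
  mem_LogAt.2 ⟨0, by rw [dP_mul_dP_mul_self, smul_zero]⟩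

lemma degProj_mem_LogAt {c : Fin ℓ → K} {η : ExtF K ℓ} (h : η ∈ LogAt c) (p : ℕ) :
    degProj _ _ p η ∈ LogAt c := by
  obtain ⟨ξ, h⟩ := mem_LogAt.1 h
  exact mem_LogAt.2 ⟨degProj _ _ (p + 1) ξ, by rw [← degProj_dP_mul, h, map_smul]⟩

/-- If `b` is prime to `α` then membership in `LogAt` may be tested after multiplying by `b`. -/
lemma mem_LogAt_of_smul_mem {c : Fin ℓ → K} {s : PS K ℓ} (hs : IsRelPrime (linP c) s)
    {η : ExtF K ℓ} (h : s • η ∈ LogAt c) : η ∈ LogAt c := by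
  obtain ⟨ξ, h⟩ := mem_LogAt.1 h
  rw [mul_smul_comm] at h
  exact mem_LogAt.2 (exists_eq_smul_of_isRelPrime hs h)

/-- Logarithmic forms of all degrees. -/
def LogE (A : Arrangement K ℓ) : Submodule (PS K ℓ) (ExtF K ℓ) := ⨅ c ∈ A.hyps, LogAt c

lemma mem_LogE {A : Arrangement K ℓ} {η : ExtF K ℓ} :
    η ∈ LogE A ↔ ∀ c ∈ A.hyps, η ∈ LogAt c := by
  simp [LogE]

lemma degProj_mem_LogE {A : Arrangement K ℓ} {η : ExtF K ℓ} (h : η ∈ LogE A) (p : ℕ) :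
    degProj _ _ p η ∈ LogE A :=
  mem_LogE.2 fun c hc => degProj_mem_LogAt (mem_LogE.1 h c hc) p

lemma mem_Omega_iff {A : Arrangement K ℓ} {p : ℕ} {η : ExtF K ℓ} :
    η ∈ Omega A (fun _ => 1) p ↔ η ∈ formsP K ℓ p ∧ η ∈ LogE A := by
  rw [mem_LogE]
  simp only [Omega, Submodule.mem_inf, Submodule.mem_iInf, Submodule.mem_comap, pow_one,
    LinearMap.mulLeft_apply, Submodule.mem_map, LinearMap.lsmul_apply]
  refine and_congr_right fun hp => forall₂_congr fun c _ => ?_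
  rw [mem_LogAt]
  constructor
  · rintro ⟨ξ, -, h⟩
    exact ⟨ξ, h.symm⟩
  · rintro ⟨ξ, h⟩
    refine ⟨degProj _ _ (p + 1) ξ, degProj_mem_formsP _ _, ?_⟩
    rw [← map_smul, ← h, degProj_dP_mul, degProj_of_mem_formsP hp]

end Forms

section Pullback

variable {n k : ℕ}

/-- The pullback on one-forms, with values in the one-forms. -/
def pullOne (e : (Fin n → K) →ₗ[K] (Fin ℓ → K)) (m : Fin ℓ → PS K ℓ) : Fin n → PS K n :=
  fun i => ∑ j, pull e (m j) * C (pullForm e (Pi.single j 1) i)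

lemma pullOne_add (e : (Fin n → K) →ₗ[K] (Fin ℓ → K)) (m m' : Fin ℓ → PS K ℓ) :
    pullOne e (m + m') = pullOne e m + pullOne e m' := by
  ext1 i
  simp [pullOne, add_mul, Finset.sum_add_distrib]

lemma pullOne_smul (e : (Fin n → K) →ₗ[K] (Fin ℓ → K)) (s : PS K ℓ) (m : Fin ℓ → PS K ℓ) :
    pullOne e (s • m) = pull e s • pullOne e m := by
  ext1 i
  simp [pullOne, mul_assoc, Finset.mul_sum]

lemma pullOne_C (e : (Fin n → K) →ₗ[K] (Fin ℓ → K)) (c : Fin ℓ → K) :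
    pullOne e (fun i => C (c i)) = fun i => C (pullForm e c i) := by
  ext1 i
  conv_rhs => rw [← sum_smul_single c, map_sum]
  simp [pullOne]

/-- Forms on the source of a linear map, as an algebra over the functions on the target. -/
@[reducible] def pullAlgebra (e : (Fin n → K) →ₗ[K] (Fin ℓ → K)) : Algebra (PS K ℓ) (ExtF K n) :=
  ((algebraMap (PS K n) (ExtF K n)).comp (pull e)).toAlgebra'
    fun s x => Algebra.commutes (pull e s) x

/-- The pullback of polynomial forms along a linear map. -/
def pullE (e : (Fin n → K) →ₗ[K] (Fin ℓ → K)) : ExtF K ℓ →+* ExtF K n :=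
  let alg := pullAlgebra e
  let f : @LinearMap (PS K ℓ) (PS K ℓ) _ _ (RingHom.id _) (Fin ℓ → PS K ℓ) (ExtF K n) _ _ _
      alg.toModule :=
    { toFun := fun m => ExteriorAlgebra.ι (PS K n) (pullOne e m)
      map_add' := fun m m' => by rw [pullOne_add, map_add]
      map_smul' := fun s m => by
        rw [pullOne_smul, map_smul, Algebra.smul_def]; rfl }
  (@ExteriorAlgebra.lift (PS K ℓ) _ (Fin ℓ → PS K ℓ) _ _ (ExtF K n) _ alg
    ⟨f, fun m => ExteriorAlgebra.ι_sq_zero _⟩).toRingHom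

lemma pullE_ι (e : (Fin n → K) →ₗ[K] (Fin ℓ → K)) (m : Fin ℓ → PS K ℓ) :
    pullE e (ExteriorAlgebra.ι _ m) = ExteriorAlgebra.ι _ (pullOne e m) := by
  let alg := pullAlgebra e
  exact @ExteriorAlgebra.lift_ι_apply (PS K ℓ) _ (Fin ℓ → PS K ℓ) _ _ (ExtF K n) _ alg _ _ m

lemma pullE_algebraMap (e : (Fin n → K) →ₗ[K] (Fin ℓ → K)) (s : PS K ℓ) :
    pullE e (algebraMap _ _ s) = algebraMap _ _ (pull e s) := by
  let alg := pullAlgebra e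
  exact @AlgHom.commutes (PS K ℓ) (ExtF K ℓ) (ExtF K n) _ _ _ _ alg _ s

lemma pullE_smul (e : (Fin n → K) →ₗ[K] (Fin ℓ → K)) (s : PS K ℓ) (η : ExtF K ℓ) :
    pullE e (s • η) = pull e s • pullE e η := by
  rw [Algebra.smul_def, map_mul, pullE_algebraMap, ← Algebra.smul_def]

lemma pullE_dP (e : (Fin n → K) →ₗ[K] (Fin ℓ → K)) (c : Fin ℓ → K) :
    pullE e (dP c) = dP (pullForm e c) := by
  rw [dP, pullE_ι, pullOne_C, dP]

lemma pullE_mem_formsP (e : (Fin n → K) →ₗ[K] (Fin ℓ → K)) {p : ℕ} {η : ExtF K ℓ}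
    (h : η ∈ formsP K ℓ p) : pullE e η ∈ formsP K n p := by
  induction p generalizing η with
  | zero =>
    rw [formsP, pow_zero, Submodule.mem_one] at h ⊢
    obtain ⟨s, rfl⟩ := h
    exact ⟨pull e s, (pullE_algebraMap e s).symm⟩
  | succ p ih =>
    rw [formsP, pow_succ', ← formsP] at h ⊢
    induction h using Submodule.mul_induction_on' with
    | mem_mul_mem m hm x hx =>
      obtain ⟨m, rfl⟩ := hm
      rw [map_mul, pullE_ι]
      exact Submodule.mul_mem_mul ⟨_, rfl⟩ (ih hx)
    | add x _ y _ hx hy => rw [map_add]; exact add_mem hx hy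

lemma pullE_pullE (f : (Fin k → K) →ₗ[K] (Fin n → K)) (e : (Fin n → K) →ₗ[K] (Fin ℓ → K))
    (η : ExtF K ℓ) : pullE f (pullE e η) = pullE (e ∘ₗ f) η := by
  induction η using dP_induction with
  | one => simp
  | add x y hx hy => simp [hx, hy]
  | smul s x hx => rw [pullE_smul, pullE_smul, pullE_smul, pull_pull, hx]
  | dmul c x hx => simp [pullE_dP, pullForm_comp, hx]

lemma pullE_id (η : ExtF K ℓ) : pullE LinearMap.id η = η := by
  induction η using dP_induction with
  | one => simp
  | add x y hx hy => simp [hx, hy]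
  | smul s x hx => rw [pullE_smul, pull_id, hx]
  | dmul c x hx => simp [pullE_dP, pullForm_id, hx]

lemma ctr_pullE (e : (Fin n → K) →ₗ[K] (Fin ℓ → K)) (w : Fin n → K) (η : ExtF K ℓ) :
    ctr w (pullE e η) = pullE e (ctr (e w) η) := by
  induction η using dP_induction with
  | one => simp [ctr_one]
  | add x y hx hy => simp [hx, hy]
  | smul s x hx => rw [pullE_smul, (ctr w).map_smul, (ctr (e w)).map_smul, pullE_smul, hx]
  | dmul c x hx =>
    rw [map_mul, pullE_dP, ctr_dP_mul, ctr_dP_mul, map_sub, pullE_smul, map_mul, pullE_dP, hx,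
      pullForm_dotProduct, pull_C]

/-- The data identifying `K^n` with a hyperplane `ker c₀` of `K^ℓ`, together with a complement. -/
structure HypSplit (c₀ : Fin ℓ → K) (e : (Fin n → K) →ₗ[K] (Fin ℓ → K)) where
  /-- a vector spanning a complement of the hyperplane -/
  v : Fin ℓ → K
  /-- the projection onto the hyperplane along `v` -/
  q : (Fin ℓ → K) →ₗ[K] (Fin n → K)
  dot_v : c₀ ⬝ᵥ v = 1
  q_comp_e : q ∘ₗ e = LinearMap.id
  e_comp_q : e ∘ₗ q = projAlong c₀ v
  e_inj : Function.Injective e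

namespace HypSplit

variable {c₀ : Fin ℓ → K} {e : (Fin n → K) →ₗ[K] (Fin ℓ → K)} (D : HypSplit c₀ e)
include D

lemma dot_e (w : Fin n → K) : c₀ ⬝ᵥ e w = 0 := by
  have h := LinearMap.congr_fun D.e_comp_q (e w)
  rw [LinearMap.comp_apply, ← LinearMap.comp_apply D.q, D.q_comp_e, projAlong_apply,
    LinearMap.id_apply, eq_comm, sub_eq_self] at h
  have h2 := congrArg (c₀ ⬝ᵥ ·) h
  simpa [D.dot_v] using h2

lemma ne_zero : c₀ ≠ 0 := by
  rintro rfl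
  simpa using D.dot_v

lemma pullForm_self : pullForm e c₀ = 0 :=
  eq_pullForm_iff.2 fun w => by rw [D.dot_e, zero_dotProduct]

lemma pullForm_pullForm (b : Fin n → K) : pullForm e (pullForm D.q b) = b := by
  rw [← pullForm_comp, D.q_comp_e, pullForm_id]

lemma pullForm_q_pullForm (c : Fin ℓ → K) :
    pullForm D.q (pullForm e c) = c - (c ⬝ᵥ D.v) • c₀ := by
  rw [← pullForm_comp, D.e_comp_q, pullForm_projAlong]

lemma pull_pull_q (p : PS K n) : pull e (pull D.q p) = p := by
  rw [pull_pull, D.q_comp_e, pull_id]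

lemma pullE_pullE_q (η : ExtF K n) : pullE e (pullE D.q η) = η := by
  rw [pullE_pullE, D.q_comp_e, pullE_id]

lemma pull_surjective : Function.Surjective (pull e) := fun p => ⟨_, D.pull_pull_q p⟩

lemma ker_pull : RingHom.ker (pull e) = Ideal.span {linP c₀} := by
  rw [← ker_pull_projAlong D.dot_v]
  ext p
  rw [RingHom.mem_ker, RingHom.mem_ker, ← D.e_comp_q, ← pull_pull]
  constructor
  · intro h
    rw [h, map_zero]
  · intro h
    rw [← D.pull_pull_q (pull e p), h, map_zero]

lemma pull_self : pull e (linP c₀) = 0 := by rw [pull_linP, D.pullForm_self, linP_zero]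

lemma pullE_dP_self : pullE e (dP c₀) = 0 := by rw [pullE_dP, D.pullForm_self, dP_zero]

lemma dP_mul_sub (η : ExtF K ℓ) :
    ∃ ξ, dP c₀ * (pullE (projAlong c₀ D.v) η - η) = linP c₀ • ξ := by
  induction η using dP_induction with
  | one => exact ⟨0, by simp⟩
  | add x y hx hy =>
    obtain ⟨ξ, hx⟩ := hx
    obtain ⟨ξ', hy⟩ := hy
    refine ⟨ξ + ξ', ?_⟩
    rw [map_add, smul_add, ← hx, ← hy]
    noncomm_ring
  | smul s x hx =>
    obtain ⟨ξ, hx⟩ := hx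
    have hidem : projAlong c₀ D.v ∘ₗ projAlong c₀ D.v = projAlong c₀ D.v := by
      refine LinearMap.ext fun u => ?_
      simp [projAlong_apply, dotProduct_sub, D.dot_v]
    have hs : s - pull (projAlong c₀ D.v) s ∈ Ideal.span {linP c₀} := by
      rw [← ker_pull_projAlong D.dot_v, RingHom.mem_ker, map_sub, sub_eq_zero, pull_pull, hidem]
    obtain ⟨r, hr⟩ := Ideal.mem_span_singleton.1 hs
    have key : pull (projAlong c₀ D.v) s • pullE (projAlong c₀ D.v) x - s • x =
        pull (projAlong c₀ D.v) s • (pullE (projAlong c₀ D.v) x - x) - linP c₀ • r • x := by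
      rw [smul_smul, ← hr, sub_smul, smul_sub]
      abel
    refine ⟨pull (projAlong c₀ D.v) s • ξ - dP c₀ * (r • x), ?_⟩
    rw [pullE_smul, key, mul_sub, mul_smul_comm, hx, smul_sub, mul_smul_comm, smul_comm]
  | dmul c x hx =>
    obtain ⟨ξ, hx⟩ := hx
    refine ⟨- (dP c * ξ), ?_⟩
    rw [map_mul, pullE_dP, pullForm_projAlong, dP_sub, dP_smul, smul_neg, ← mul_smul_comm, ← hx]
    simp only [sub_mul, mul_sub, smul_mul_assoc, mul_smul_comm, dP_mul_dP_mul_self, smul_zero,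
      sub_zero]
    rw [dP_mul_dP_mul c₀, dP_mul_dP_mul c₀ c x]
    abel

lemma pullE_eq_zero_iff {η : ExtF K ℓ} : pullE e η = 0 ↔ η ∈ LogAt c₀ := by
  constructor
  · intro h
    obtain ⟨ξ, hξ⟩ := D.dP_mul_sub η
    rw [← D.e_comp_q, ← pullE_pullE, h, map_zero, zero_sub] at hξ
    exact mem_LogAt.2 ⟨-ξ, by rw [smul_neg, ← hξ]; simp⟩
  · intro h
    obtain ⟨a, b, rfl⟩ := (mem_LogAt_iff D.ne_zero).1 h
    rw [map_add, pullE_smul, map_mul, D.pull_self, D.pullE_dP_self, zero_smul, zero_mul, add_zero]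

/-- Contracting `dα ∧ ζ` with the transversal vector recovers the restriction of `ζ`. -/
lemma pullE_ctr_dP_mul (ζ : ExtF K ℓ) : pullE e (ctr D.v (dP c₀ * ζ)) = pullE e ζ := by
  rw [ctr_dP_mul, D.dot_v, C_1, one_smul, map_sub, map_mul, D.pullE_dP_self, zero_mul, sub_zero]

end HypSplit

end Pullback

section HypEmbedding

lemma IsHypEmbedding.nonempty_hypSplit {c₀ : Fin ℓ → K} (hc : c₀ ≠ 0)
    {e : (Fin (ℓ - 1) → K) →ₗ[K] (Fin ℓ → K)} (h : IsHypEmbedding c₀ e) :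
    Nonempty (HypSplit c₀ e) := by
  obtain ⟨v, hv⟩ := exists_dotProduct_eq_one hc
  have hmem : ∀ u, projAlong c₀ v u ∈ LinearMap.range e := fun u => by
    rw [h.2, LinearMap.mem_ker, dotLin_apply, projAlong_apply, dotProduct_sub, dotProduct_smul, hv,
      smul_eq_mul, mul_one, sub_self]
  have hq : ∀ u, e ((LinearEquiv.ofInjective e h.1).symm
      ((projAlong c₀ v).codRestrict _ hmem u)) = projAlong c₀ v u := fun u =>
    congrArg Subtype.val ((LinearEquiv.ofInjective e h.1).apply_symm_apply
      ((projAlong c₀ v).codRestrict _ hmem u))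
  refine ⟨⟨v, (LinearEquiv.ofInjective e h.1).symm.toLinearMap ∘ₗ
    (projAlong c₀ v).codRestrict _ hmem, hv, ?_, LinearMap.ext hq, h.1⟩⟩
  refine LinearMap.ext fun w => h.1 ((hq (e w)).trans ?_)
  have : c₀ ⬝ᵥ e w = 0 := by
    rw [← dotLin_apply, ← LinearMap.mem_ker, ← h.2]
    exact ⟨w, rfl⟩
  rw [projAlong_apply, this, zero_smul, sub_zero]
  rfl

end HypEmbedding

section SmallCodegree

variable {n : ℕ}

/-- Logarithmic forms are a second syzygy module. -/
def logMap (B : Arrangement K n) (p : ℕ) :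
    (formsP K n p × (B.hyps → ExtF K n)) →ₗ[PS K n] (B.hyps → ExtF K n) :=
  LinearMap.pi fun c =>
    LinearMap.mulLeft (PS K n) (dP c.1) ∘ₗ (formsP K n p).subtype ∘ₗ LinearMap.fst _ _ _ -
      LinearMap.lsmul (PS K n) (ExtF K n) (linP c.1) ∘ₗ LinearMap.proj c ∘ₗ LinearMap.snd _ _ _

lemma mem_ker_logMap {B : Arrangement K n} {p : ℕ}
    {x : formsP K n p × (B.hyps → ExtF K n)} :
    x ∈ LinearMap.ker (logMap B p) ↔ ∀ c : B.hyps, dP c.1 * (x.1 : ExtF K n) =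
      linP c.1 • x.2 c := by
  simp only [LinearMap.mem_ker, funext_iff, logMap, LinearMap.pi_apply, Pi.zero_apply,
    LinearMap.sub_apply, sub_eq_zero]
  rfl

lemma pdLE_Omega_of_le (B : Arrangement K n) {p : ℕ} (h : n ≤ p + 2) :
    pdLE (PS K n) p (Omega B (fun _ => 1) p) := by
  have h1 : pdLE (PS K n) p (LinearMap.ker (logMap B p)) :=
    pdLE_ker_of_projective _ (pdLE_mono h (globalDimLE_mvPolynomial K n _))
  let f : LinearMap.ker (logMap B p) →ₗ[PS K n] Omega B (fun _ => 1) p :=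
    ((formsP K n p).subtype ∘ₗ LinearMap.fst _ _ _ ∘ₗ
      (LinearMap.ker (logMap B p)).subtype).codRestrict _ fun x =>
        mem_Omega_iff.2 ⟨x.1.1.2, mem_LogE.2 fun c hc =>
          mem_LogAt.2 ⟨_, mem_ker_logMap.1 x.2 ⟨c, hc⟩⟩⟩
  refine pdLE_of_linearEquiv (LinearEquiv.ofBijective f ⟨?_, ?_⟩) h1
  · intro x y hxy
    have h2 : x.1.1 = y.1.1 :=
      Subtype.ext (congrArg (Subtype.val : Omega B (fun _ => 1) p → ExtF K n) hxy)
    refine Subtype.ext (Prod.ext h2 (funext fun c => ?_))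
    refine smul_right_injective _ (linP_ne_zero (B.ne_zero c.1 c.2)) ?_
    change linP c.1 • x.1.2 c = linP c.1 • y.1.2 c
    rw [← mem_ker_logMap.1 x.2 c, ← mem_ker_logMap.1 y.2 c, h2]
  · intro η
    obtain ⟨h2, h3⟩ := mem_Omega_iff.1 η.2
    choose ξ hξ using fun c : B.hyps => mem_LogAt.1 (mem_LogE.1 h3 c.1 c.2)
    exact ⟨⟨(⟨η, h2⟩, ξ), mem_ker_logMap.2 hξ⟩, rfl⟩

end SmallCodegree

section RestrictionMap

variable {n : ℕ} {c₀ : Fin ℓ → K} {e : (Fin n → K) →ₗ[K] (Fin ℓ → K)}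

/-- The hyperplanes other than `ker c₀` restricting to the hyperplane `ker b`. -/
def fibre (A : Arrangement K ℓ) (c₀ : Fin ℓ → K) (e : (Fin n → K) →ₗ[K] (Fin ℓ → K))
    (b : Fin n → K) : Finset (Fin ℓ → K) :=
  A.hyps.filter fun c => c ≠ c₀ ∧ ∃ t : K, t ≠ 0 ∧ pullForm e c = t • b

lemma mem_fibre {A : Arrangement K ℓ} {b : Fin n → K} {c : Fin ℓ → K} :
    c ∈ fibre A c₀ e b ↔ c ∈ A.hyps ∧ c ≠ c₀ ∧ ∃ t : K, t ≠ 0 ∧ pullForm e c = t • b :=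
  Finset.mem_filter

lemma isRelPrime_hyps {A : Arrangement K ℓ} {c c' : Fin ℓ → K} (hc : c ∈ A.hyps)
    (hc' : c' ∈ A.hyps) (h : c ≠ c') : IsRelPrime (linP c) (linP c') :=
  isRelPrime_linP (A.ne_zero c hc) fun t => A.nonprop c' hc' c hc h.symm t

lemma exists_pull_prod_fibre {b : Fin n → K} {s : Finset (Fin ℓ → K)}
    (hs : ∀ c ∈ s, ∃ t : K, t ≠ 0 ∧ pullForm e c = t • b) :
    ∃ u : K, u ≠ 0 ∧ pull e (∏ c ∈ s, linP c) = C u * linP b ^ s.card := by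
  induction s using Finset.induction_on with
  | empty => exact ⟨1, one_ne_zero, by simp⟩
  | insert a s ha ih =>
    obtain ⟨u, hu, h⟩ := ih fun c hc => hs c (Finset.mem_insert_of_mem hc)
    obtain ⟨t, ht, h'⟩ := hs a (Finset.mem_insert_self _ _)
    refine ⟨t * u, mul_ne_zero ht hu, ?_⟩
    rw [Finset.prod_insert ha, map_mul, h, pull_linP, h', linP_smul, Finset.card_insert_of_notMem ha,
      C_mul]
    ring

lemma C_smul_C_inv_smul {t : K} (ht : t ≠ 0) (x : ExtF K ℓ) :
    (C t : PS K ℓ) • (C t⁻¹ : PS K ℓ) • x = x := by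
  rw [smul_smul, ← C_mul, mul_inv_cancel₀ ht, C_1, one_smul]

variable (D : HypSplit c₀ e) {A : Arrangement K ℓ} {b : Fin n → K}
include D

lemma HypSplit.eq_of_pullForm {c : Fin ℓ → K} {t : K} (h : pullForm e c = t • b) :
    c = (c ⬝ᵥ D.v) • c₀ + t • pullForm D.q b := by
  rw [← map_smul, ← h, D.pullForm_q_pullForm]
  abel

/-- The multiplicity of the restriction of a form with poles along a fibre. -/
lemma HypSplit.dP_mul_pullE {s : Finset (Fin ℓ → K)} (hs : s ⊆ fibre A c₀ e b) {ζ : ExtF K ℓ}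
    (hζ : ∀ c ∈ s, ζ ∈ LogAt c) :
    ∃ ξ, dP b * pullE e ζ = linP b ^ s.card • ξ := by
  have h1 : ∃ ξ, dP c₀ * (dP (pullForm D.q b) * ζ) = (∏ c ∈ s, linP c) • ξ := by
    refine exists_eq_prod_smul (fun c hc c' hc' h => ?_) fun c hc => ?_
    · exact isRelPrime_hyps (mem_fibre.1 (hs hc)).1 (mem_fibre.1 (hs hc')).1 h
    · obtain ⟨-, -, t, ht, hct⟩ := mem_fibre.1 (hs hc)
      obtain ⟨ξ, hξ⟩ := mem_LogAt.1 (hζ c hc)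
      refine ⟨(C t⁻¹ : PS K ℓ) • (dP c₀ * ξ), ?_⟩
      have h2 : dP c₀ * (dP c * ζ) = (C t : PS K ℓ) • (dP c₀ * (dP (pullForm D.q b) * ζ)) := by
        conv_lhs => rw [D.eq_of_pullForm hct]
        rw [dP_add, dP_smul, dP_smul]
        simp only [add_mul, mul_add, smul_mul_assoc, mul_smul_comm, dP_mul_dP_mul_self, smul_zero,
          zero_add]
      rw [hξ, mul_smul_comm] at h2
      rw [smul_comm, h2, smul_comm, C_smul_C_inv_smul ht]
  obtain ⟨ξ, h1⟩ := h1
  obtain ⟨u, -, hu⟩ := exists_pull_prod_fibre fun c hc => (mem_fibre.1 (hs hc)).2.2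
  have h2 := congrArg (fun z => pullE e (ctr D.v z)) h1
  rw [D.pullE_ctr_dP_mul, map_mul, pullE_dP, D.pullForm_pullForm, (ctr D.v).map_smul,
    pullE_smul, hu] at h2
  exact ⟨(C u : PS K n) • pullE e (ctr D.v ξ), by rw [h2, smul_smul, mul_comm]⟩

lemma HypSplit.pullE_eq_smul (hb : b ≠ 0) {η : ExtF K ℓ}
    (hη : ∀ c ∈ fibre A c₀ e b, η ∈ LogAt c) :
    ∃ ξ, pullE e η = linP b ^ ((fibre A c₀ e b).card - 1) • ξ := by
  rcases Nat.eq_zero_or_pos (fibre A c₀ e b).card with h0 | hpos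
  · exact ⟨pullE e η, by rw [h0]; simp⟩
  obtain ⟨w, hw⟩ := exists_dotProduct_eq_one hb
  set b' := pullForm D.q b with hb'
  let θ : ExtF K ℓ → ExtF K ℓ := fun x => linP c₀ • ctr D.v x + linP b' • ctr (e w) x
  have hθ : ∀ c ∈ fibre A c₀ e b, θ η ∈ LogAt c := fun c hc => by
    obtain ⟨-, -, t, ht, hct⟩ := mem_fibre.1 hc
    obtain ⟨ξ, hξ⟩ := mem_LogAt.1 (hη c hc)
    have h1 : θ (dP c * η) = linP c • η - dP c * θ η := by
      have h2 : c ⬝ᵥ e w = t := by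
        rw [← pullForm_dotProduct, hct, smul_dotProduct, hw, smul_eq_mul, mul_one]
      have h3 : linP c = C (c ⬝ᵥ D.v) * linP c₀ + C t * linP b' := by
        rw [← linP_smul, ← linP_smul, ← linP_add, ← D.eq_of_pullForm hct]
      simp only [θ]
      rw [ctr_dP_mul, ctr_dP_mul, h2, h3]
      simp only [smul_sub, mul_add, mul_smul_comm, add_smul, mul_smul]
      rw [smul_comm (linP c₀) (C (c ⬝ᵥ D.v) : PS K ℓ), smul_comm (linP b') (C t : PS K ℓ)]
      abel
    have h2 : θ (linP c • ξ) = linP c • θ ξ := by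
      simp only [θ]
      rw [(ctr D.v).map_smul, (ctr (e w)).map_smul, smul_add, smul_comm (linP c₀) (linP c),
        smul_comm (linP b') (linP c)]
    refine mem_LogAt.2 ⟨η - θ ξ, ?_⟩
    rw [smul_sub, ← h2, ← hξ, h1, sub_sub_cancel]
  have hθe : pullE e (θ η) = linP b • ctr w (pullE e η) := by
    simp only [θ]
    rw [map_add, pullE_smul, pullE_smul, D.pull_self, zero_smul, zero_add, pull_linP,
      D.pullForm_pullForm, ctr_pullE]
  obtain ⟨ξ, hξ⟩ := D.dP_mul_pullE subset_rfl hη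
  obtain ⟨ξ', hξ'⟩ := D.dP_mul_pullE subset_rfl hθ
  obtain ⟨m, hm⟩ := Nat.exists_eq_add_of_lt hpos
  rw [zero_add] at hm
  rw [hm] at hξ hξ' ⊢
  rw [hθe, mul_smul_comm, pow_succ', mul_smul] at hξ'
  have h4 : dP b * ctr w (pullE e η) = linP b ^ m • ξ' :=
    smul_right_injective _ (linP_ne_zero hb) hξ'
  have h5 := congrArg (ctr w) hξ
  rw [ctr_dP_mul, hw, C_1, one_smul, h4, (ctr w).map_smul, sub_eq_iff_eq_add] at h5
  exact ⟨linP b • ctr w ξ + ξ', by rw [h5, Nat.add_sub_cancel, smul_add, smul_smul, pow_succ]⟩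

end RestrictionMap

section RestrictionMapGlobal

variable {n : ℕ} {c₀ : Fin ℓ → K} {e : (Fin n → K) →ₗ[K] (Fin ℓ → K)}

/-- The product of the forms of the restriction, raised to the Ziegler multiplicities minus one. -/
def multPoly (A : Arrangement K ℓ) (c₀ : Fin ℓ → K) (e : (Fin n → K) →ₗ[K] (Fin ℓ → K))
    (B : Arrangement K n) : PS K n :=
  ∏ b ∈ B.hyps, linP b ^ ((fibre A c₀ e b).card - 1)

lemma multPoly_ne_zero (A : Arrangement K ℓ) (c₀ : Fin ℓ → K)
    (e : (Fin n → K) →ₗ[K] (Fin ℓ → K)) (B : Arrangement K n) : multPoly A c₀ e B ≠ 0 :=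
  Finset.prod_ne_zero_iff.2 fun b hb => pow_ne_zero _ (linP_ne_zero (B.ne_zero b hb))

lemma isRelPrime_prod_erase (B : Arrangement K n) (f : (Fin n → K) → ℕ) {b : Fin n → K}
    (hb : b ∈ B.hyps) : IsRelPrime (linP b) (∏ b' ∈ B.hyps.erase b, linP b' ^ f b') :=
  IsRelPrime.prod_right fun _ hb' =>
    (isRelPrime_hyps hb (Finset.mem_of_mem_erase hb') (Finset.ne_of_mem_erase hb').symm).pow_right

lemma mem_LogE_iff_delArr {A : Arrangement K ℓ} (hc₀ : c₀ ∈ A.hyps) {η : ExtF K ℓ} :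
    η ∈ LogE A ↔ η ∈ LogE (delArr A c₀) ∧ η ∈ LogAt c₀ := by
  rw [mem_LogE, mem_LogE]
  constructor
  · exact fun h => ⟨fun c hc => h c (Finset.mem_of_mem_erase hc), h c₀ hc₀⟩
  · rintro ⟨h1, h2⟩ c hc
    by_cases h : c = c₀
    · rwa [h]
    · exact h1 c (Finset.mem_erase.2 ⟨h, hc⟩)

variable (D : HypSplit c₀ e) {A : Arrangement K ℓ} {B : Arrangement K n}
include D

lemma HypSplit.exists_pullE_eq_smul (hB : ∀ b ∈ B.hyps, (fibre A c₀ e b).Nonempty)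
    {η : ExtF K ℓ} (hη : η ∈ LogE (delArr A c₀)) :
    ∃ ω ∈ LogE B, pullE e η = multPoly A c₀ e B • ω := by
  have hη' : ∀ b, ∀ c ∈ fibre A c₀ e b, η ∈ LogAt c := fun b c hc =>
    mem_LogE.1 hη c (Finset.mem_erase.2 ⟨(mem_fibre.1 hc).2.1, (mem_fibre.1 hc).1⟩)
  obtain ⟨ω, hω⟩ : ∃ ω, pullE e η = multPoly A c₀ e B • ω :=
    exists_eq_prod_smul (fun b hb b' hb' h => (isRelPrime_hyps hb hb' h).pow)
      fun b hb => D.pullE_eq_smul (B.ne_zero b hb) (hη' b)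
  refine ⟨ω, mem_LogE.2 fun b hb => ?_, hω⟩
  refine mem_LogAt_of_smul_mem
    (isRelPrime_prod_erase B (fun b => (fibre A c₀ e b).card - 1) hb) ?_
  obtain ⟨ξ, hξ⟩ := D.dP_mul_pullE subset_rfl (hη' b)
  refine mem_LogAt.2 ⟨ξ, smul_right_injective _
    (pow_ne_zero ((fibre A c₀ e b).card - 1) (linP_ne_zero (B.ne_zero b hb))) ?_⟩
  have hcard : (fibre A c₀ e b).card - 1 + 1 = (fibre A c₀ e b).card :=
    Nat.sub_add_cancel (Finset.card_pos.2 (hB b hb))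
  change _ • (dP b * _) = _ • (linP b • ξ)
  rw [smul_smul, ← pow_succ, hcard, ← hξ, hω, multPoly, ← Finset.mul_prod_erase _ _ hb, mul_smul,
    mul_smul_comm, mul_smul_comm, mul_smul_comm]

lemma HypSplit.exists_Omega_smul_eq (hB : ∀ b ∈ B.hyps, (fibre A c₀ e b).Nonempty) {p : ℕ}
    (η : Omega (delArr A c₀) (fun _ => 1) p) :
    ∃ ω : Omega B (fun _ => 1) p, multPoly A c₀ e B • (ω : ExtF K n) = pullE e η := by
  obtain ⟨h1, h2⟩ := mem_Omega_iff.1 η.2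
  obtain ⟨ω, hω, h⟩ := D.exists_pullE_eq_smul hB h2
  refine ⟨⟨ω, mem_Omega_iff.2 ⟨mem_formsP_of_smul_mem (multPoly_ne_zero A c₀ e B) ?_, hω⟩⟩, h.symm⟩
  rw [← h]
  exact pullE_mem_formsP e h1

/-- Restriction of logarithmic forms of the deletion to the hyperplane. -/
def HypSplit.resMap (hB : ∀ b ∈ B.hyps, (fibre A c₀ e b).Nonempty) (p : ℕ) :
    Omega (delArr A c₀) (fun _ => 1) p →ₛₗ[pull e] Omega B (fun _ => 1) p :=
  have H := D.exists_Omega_smul_eq hB (p := p)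
  { toFun := fun η => (H η).choose
    map_add' := fun η ξ => by
      refine Subtype.ext (smul_right_injective _ (multPoly_ne_zero A c₀ e B) ?_)
      refine (H (η + ξ)).choose_spec.trans ?_
      change _ = multPoly A c₀ e B • ((H η).choose.1 + (H ξ).choose.1)
      rw [smul_add, (H η).choose_spec, (H ξ).choose_spec, ← map_add]
      rfl
    map_smul' := fun s η => by
      refine Subtype.ext (smul_right_injective _ (multPoly_ne_zero A c₀ e B) ?_)
      refine (H (s • η)).choose_spec.trans ?_
      change _ = multPoly A c₀ e B • (pull e s • (H η).choose.1)
      rw [smul_comm, (H η).choose_spec, ← pullE_smul]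
      rfl }

lemma HypSplit.smul_resMap (hB : ∀ b ∈ B.hyps, (fibre A c₀ e b).Nonempty) {p : ℕ}
    (η : Omega (delArr A c₀) (fun _ => 1) p) :
    multPoly A c₀ e B • (D.resMap hB p η : ExtF K n) = pullE e η :=
  (D.exists_Omega_smul_eq hB η).choose_spec

lemma HypSplit.resMap_eq (hB : ∀ b ∈ B.hyps, (fibre A c₀ e b).Nonempty) {p : ℕ}
    {η : Omega (delArr A c₀) (fun _ => 1) p} {ω : Omega B (fun _ => 1) p}
    (h : pullE e η = multPoly A c₀ e B • (ω : ExtF K n)) : D.resMap hB p η = ω :=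
  Subtype.ext (smul_right_injective _ (multPoly_ne_zero A c₀ e B) ((D.smul_resMap hB η).trans h))

lemma HypSplit.resMap_eq_zero_iff (hB : ∀ b ∈ B.hyps, (fibre A c₀ e b).Nonempty) {p : ℕ}
    (hc₀ : c₀ ∈ A.hyps) {η : Omega (delArr A c₀) (fun _ => 1) p} :
    D.resMap hB p η = 0 ↔ (η : ExtF K ℓ) ∈ Omega A (fun _ => 1) p := by
  obtain ⟨h1, h2⟩ := mem_Omega_iff.1 η.2
  rw [mem_Omega_iff, mem_LogE_iff_delArr hc₀, ← D.pullE_eq_zero_iff, ← D.smul_resMap hB,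
    smul_eq_zero_iff_right (multPoly_ne_zero A c₀ e B)]
  simp [h1, h2]

/-- The kernel of the restriction map is the module of logarithmic forms of `A`. -/
lemma HypSplit.nonempty_kerResMapEquiv (hB : ∀ b ∈ B.hyps, (fibre A c₀ e b).Nonempty) (p : ℕ)
    (hc₀ : c₀ ∈ A.hyps) :
    Nonempty (LinearMap.ker (D.resMap hB p) ≃ₗ[PS K ℓ] Omega A (fun _ => 1) p) := by
  have hle : Omega A (fun _ => 1) p ≤ Omega (delArr A c₀) (fun _ => 1) p := fun η hη =>
    mem_Omega_iff.2 ⟨(mem_Omega_iff.1 hη).1,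
      ((mem_LogE_iff_delArr hc₀).1 (mem_Omega_iff.1 hη).2).1⟩
  have hker : LinearMap.ker (D.resMap hB p) = LinearMap.range (Submodule.inclusion hle) := by
    ext η
    rw [LinearMap.mem_ker, D.resMap_eq_zero_iff hB hc₀, Submodule.range_inclusion,
      Submodule.mem_comap, Submodule.subtype_apply]
  exact ⟨(LinearEquiv.ofEq _ _ hker).trans
    (LinearEquiv.ofInjective _ (Submodule.inclusion_injective hle)).symm⟩

end RestrictionMapGlobal

section ExteriorPowers

variable {R M N : Type*} [CommRing R] [AddCommGroup M] [Module R M] [AddCommGroup N] [Module R N]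

lemma exteriorAlgebra_map_mem (f : M →ₗ[R] N) {p : ℕ} {x : ExteriorAlgebra R M}
    (h : x ∈ ⋀[R]^p M) : ExteriorAlgebra.map f x ∈ ⋀[R]^p N := by
  have h1 : ExteriorAlgebra.map f x ∈
      Submodule.map (ExteriorAlgebra.map f).toLinearMap (⋀[R]^p M) := ⟨x, h, rfl⟩
  rw [ExteriorAlgebra.exteriorPower, Submodule.map_pow] at h1
  refine (pow_le_pow_left' ?_ p : _ ≤ (LinearMap.range (ExteriorAlgebra.ι R : N →ₗ[R] _)) ^ p) h1
  rintro _ ⟨_, ⟨m, rfl⟩, rfl⟩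
  exact ⟨f m, (ExteriorAlgebra.map_apply_ι f m).symm⟩

lemma exteriorPower_induction {p : ℕ} {P : ℕ → ExteriorAlgebra R M → Prop}
    (zero : ∀ r : R, P 0 (algebraMap _ _ r)) (add : ∀ q x y, P q x → P q y → P q (x + y))
    (mul : ∀ q m x, x ∈ ⋀[R]^q M → P q x → P (q + 1) (ExteriorAlgebra.ι R m * x))
    {x : ExteriorAlgebra R M} (h : x ∈ ⋀[R]^p M) : P p x := by
  induction p generalizing x with
  | zero =>
    rw [ExteriorAlgebra.exteriorPower, pow_zero, Submodule.mem_one] at h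
    obtain ⟨s, rfl⟩ := h
    exact zero s
  | succ p ih =>
    rw [ExteriorAlgebra.exteriorPower, pow_succ'] at h
    induction h using Submodule.mul_induction_on' with
    | mem_mul_mem m hm x hx =>
      obtain ⟨m, rfl⟩ := hm
      exact mul p m x hx (ih hx)
    | add x _ y _ hx hy => exact add _ x y hx hy

lemma exteriorAlgebra_map_smul_id (r : R) {p : ℕ} {x : ExteriorAlgebra R M}
    (h : x ∈ ⋀[R]^p M) : ExteriorAlgebra.map (r • LinearMap.id) x = r ^ p • x := by
  refine exteriorPower_induction
    (P := fun p x => ExteriorAlgebra.map (r • LinearMap.id) x = r ^ p • x) (fun s => by simp)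
    (fun q x y hx hy => ?_) (fun q m x _ hx => ?_) h
  · rw [map_add, hx, hy, smul_add]
  · rw [map_mul, hx, ExteriorAlgebra.map_apply_ι, LinearMap.smul_apply, map_smul,
      LinearMap.id_apply, smul_mul_smul_comm, pow_succ']

end ExteriorPowers

section FreeArrangement

lemma mem_formsP_one {η : ExtF K ℓ} :
    η ∈ formsP K ℓ 1 ↔ ∃ m, ExteriorAlgebra.ι (PS K ℓ) m = η := by
  rw [formsP, pow_one, LinearMap.mem_range]

lemma dP_mem_formsP_one (c : Fin ℓ → K) : dP c ∈ formsP K ℓ 1 := mem_formsP_one.2 ⟨_, rfl⟩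

/-- The product of two forms logarithmic along `α`, the first of degree one, gains a factor `α`. -/
lemma exists_mul_eq_smul {c : Fin ℓ → K} (hc : c ≠ 0) {f ζ : ExtF K ℓ} (hf1 : f ∈ formsP K ℓ 1)
    (hf : f ∈ LogAt c) (hζ : ζ ∈ LogAt c) : ∃ ξ ∈ LogAt c, f * ζ = linP c • ξ := by
  obtain ⟨m, rfl⟩ := mem_formsP_one.1 hf1
  obtain ⟨ξ, hξ⟩ := mem_LogAt.1 hf
  obtain ⟨v, hv⟩ := exists_dotProduct_eq_one hc
  obtain ⟨s, hs⟩ : ∃ s : PS K ℓ, ctr v (ExteriorAlgebra.ι _ m) = algebraMap _ _ s :=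
    ⟨_, CliffordAlgebra.contractLeft_ι _ (vecDual v) m⟩
  have h1 := congrArg (ctr v) hξ
  rw [ctr_dP_mul, hv, C_1, one_smul, (ctr v).map_smul, hs, ← Algebra.commutes,
    ← Algebra.smul_def, sub_eq_iff_eq_add] at h1
  have h2 := congrArg (degProj _ _ 1) h1
  rw [degProj_of_mem_formsP hf1, map_add, map_smul, map_smul,
    degProj_of_mem_formsP (dP_mem_formsP_one c)] at h2
  obtain ⟨u, hu⟩ := mem_formsP_one.1 (degProj_mem_formsP 1 (ctr v ξ))
  rw [← hu] at h2
  obtain ⟨a, b, hab⟩ := (mem_LogAt_iff hc).1 hζ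
  obtain ⟨ξ', hξ'⟩ := mem_LogAt.1 hζ
  refine ⟨ExteriorAlgebra.ι _ u * ζ + s • (dP c * a), add_mem ?_ ?_, ?_⟩
  · refine mem_LogAt.2 ⟨-(ExteriorAlgebra.ι _ u * ξ'), ?_⟩
    rw [← mul_assoc, dP, eq_neg_of_add_eq_zero_left (ExteriorAlgebra.ι_add_mul_swap _ _), ← dP,
      neg_mul, mul_assoc, hξ', mul_smul_comm, smul_neg]
  · exact Submodule.smul_mem _ _ (dP_mul_mem_LogAt _ _)
  · rw [h2, add_mul, smul_mul_assoc, smul_add, smul_mul_assoc]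
    congr 1
    conv_lhs => rw [hab]
    rw [mul_add, dP_mul_dP_mul_self, add_zero, mul_smul_comm, smul_comm]

variable (A : Arrangement K ℓ)

/-- The defining polynomial of an arrangement. -/
def defPoly : PS K ℓ := ∏ c ∈ A.hyps, linP c

variable {A}

lemma defPoly_ne_zero : defPoly A ≠ 0 :=
  Finset.prod_ne_zero_iff.2 fun c hc => linP_ne_zero (A.ne_zero c hc)

lemma exists_defPoly_smul {M : Type*} [AddCommGroup M] [Module (PS K ℓ) M]
    [Module.Free (PS K ℓ) M] (k : ℕ) {m : M} (h : ∀ c ∈ A.hyps, ∃ w, m = linP c ^ k • w) :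
    ∃ w, m = defPoly A ^ k • w := by
  obtain ⟨w, hw⟩ := exists_eq_prod_smul
    (fun c hc c' hc' hne => (isRelPrime_hyps hc hc' hne).pow (m := k) (n := k)) h
  exact ⟨w, by rw [hw, defPoly, Finset.prod_pow]⟩

lemma smul_prod_mem_LogE {s : Finset (Fin ℓ → K)} {η : ExtF K ℓ}
    (h : ∀ c ∈ A.hyps, c ∉ s → η ∈ LogAt c) : (∏ c ∈ s, linP c) • η ∈ LogE A := by
  refine mem_LogE.2 fun c hc => ?_
  by_cases hcs : c ∈ s
  · rw [← Finset.mul_prod_erase _ _ hcs, mul_smul]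
    exact smul_mem_LogAt _ _
  · exact Submodule.smul_mem _ _ (h c hc hcs)

lemma defPoly_smul_mem_LogE (η : ExtF K ℓ) : defPoly A • η ∈ LogE A :=
  smul_prod_mem_LogE fun _ hc h => absurd hc h

variable (A) in
/-- Logarithmic one-forms, viewed as one-forms. -/
def logOneVal : Omega A (fun _ => 1) 1 →ₗ[PS K ℓ] (Fin ℓ → PS K ℓ) :=
  ExteriorAlgebra.ιInv ∘ₗ (Omega A (fun _ => 1) 1).subtype

lemma ι_logOneVal (f : Omega A (fun _ => 1) 1) :
    ExteriorAlgebra.ι _ (logOneVal A f) = (f : ExtF K ℓ) := by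
  obtain ⟨m, hm⟩ := mem_formsP_one.1 (mem_Omega_iff.1 f.2).1
  rw [logOneVal, LinearMap.comp_apply, Submodule.subtype_apply, ← hm,
    ExteriorAlgebra.ι_leftInverse m]

variable (A) in
/-- Multiplication by the defining polynomial, from one-forms to logarithmic one-forms. -/
def logOneMul : (Fin ℓ → PS K ℓ) →ₗ[PS K ℓ] Omega A (fun _ => 1) 1 :=
  (defPoly A • ExteriorAlgebra.ι (PS K ℓ)).codRestrict _ fun m =>
    mem_Omega_iff.2 ⟨Submodule.smul_mem _ _ (mem_formsP_one.2 ⟨m, rfl⟩), defPoly_smul_mem_LogE _⟩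

lemma logOneVal_comp_logOneMul :
    logOneVal A ∘ₗ logOneMul A = defPoly A • LinearMap.id := by
  refine LinearMap.ext fun m => (ExteriorAlgebra.ι_inj (PS K ℓ) _ _).1 ?_
  rw [LinearMap.comp_apply, ι_logOneVal, LinearMap.smul_apply, map_smul]
  rfl

lemma exists_logOneMul_eq {c : Fin ℓ → K} (hc : c ∈ A.hyps) :
    ∃ f, logOneMul A (fun i => C (c i)) = linP c • f := by
  refine ⟨⟨(∏ c' ∈ A.hyps.erase c, linP c') • dP c, mem_Omega_iff.2
    ⟨Submodule.smul_mem _ _ (dP_mem_formsP_one c), smul_prod_mem_LogE fun c' hc' h => ?_⟩⟩, ?_⟩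
  · have : c' = c := by
      by_contra h'
      exact h (Finset.mem_erase.2 ⟨h', hc'⟩)
    rw [this]
    simpa using dP_mul_mem_LogAt c 1
  · refine Subtype.ext ?_
    change defPoly A • dP c = linP c • (∏ c' ∈ A.hyps.erase c, linP c') • dP c
    rw [smul_smul, Finset.mul_prod_erase _ _ hc, defPoly]

section FreeModel

variable {F : Type*} [AddCommGroup F] [Module (PS K ℓ) F] {φ : (Fin ℓ → PS K ℓ) →ₗ[PS K ℓ] F}
  {ψ : F →ₗ[PS K ℓ] (Fin ℓ → PS K ℓ)}

lemma exists_map_eq_defPoly_smul [Module.Free (PS K ℓ) F]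
    (hφ : ∀ c ∈ A.hyps, ∃ f, φ (fun i => C (c i)) = linP c • f) {η : ExtF K ℓ} (hη : η ∈ LogE A) :
    ∃ x, ExteriorAlgebra.map φ η = defPoly A • x := by
  have := free_exteriorAlgebra (PS K ℓ) F
  have h := exists_defPoly_smul (A := A) 1 (m := ExteriorAlgebra.map φ η) fun c hc => by
    obtain ⟨a, b, rfl⟩ := (mem_LogAt_iff (A.ne_zero c hc)).1 (mem_LogE.1 hη c hc)
    obtain ⟨f, hf⟩ := hφ c hc
    refine ⟨ExteriorAlgebra.map φ a + ExteriorAlgebra.ι _ f * ExteriorAlgebra.map φ b, ?_⟩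
    rw [map_add, map_smul, map_mul, dP, ExteriorAlgebra.map_apply_ι, hf, map_smul, pow_one,
      smul_add, smul_mul_assoc]
  rwa [pow_one] at h

lemma exists_smul_map_eq {c : Fin ℓ → K} (hc : c ≠ 0)
    (hψ : ∀ f, ExteriorAlgebra.ι (PS K ℓ) (ψ f) ∈ LogAt c) {p : ℕ}
    {x : ExteriorAlgebra (PS K ℓ) F} (hx : x ∈ ⋀[PS K ℓ]^p F) :
    ∃ ζ ∈ LogAt c, linP c • ExteriorAlgebra.map ψ x = linP c ^ p • ζ := by
  refine exteriorPower_induction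
    (P := fun p x => ∃ ζ ∈ LogAt c, linP c • ExteriorAlgebra.map ψ x = linP c ^ p • ζ)
    (fun s => ⟨_, smul_mem_LogAt c _, by rw [pow_zero, one_smul]⟩) ?_ ?_ hx
  · rintro q x y ⟨ζ, h1, h2⟩ ⟨ζ', h1', h2'⟩
    exact ⟨_, add_mem h1 h1', by rw [map_add, smul_add, h2, h2', smul_add]⟩
  · rintro q f x - ⟨ζ, h1, h2⟩
    obtain ⟨ξ, h3, h4⟩ := exists_mul_eq_smul hc (mem_formsP_one.2 ⟨_, rfl⟩) (hψ f) h1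
    refine ⟨ξ, h3, ?_⟩
    rw [map_mul, ExteriorAlgebra.map_apply_ι, ← mul_smul_comm, h2, mul_smul_comm, h4,
      smul_smul, pow_succ]

lemma exists_defPoly_smul_map_eq (hψ : ∀ f, ExteriorAlgebra.ι (PS K ℓ) (ψ f) ∈ LogE A) {p : ℕ}
    {x : ExteriorAlgebra (PS K ℓ) F} (hx : x ∈ ⋀[PS K ℓ]^p F) :
    ∃ ζ ∈ LogE A, defPoly A • ExteriorAlgebra.map ψ x = defPoly A ^ p • ζ := by
  rcases p with _ | p
  · exact ⟨_, defPoly_smul_mem_LogE _, by rw [pow_zero, one_smul]⟩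
  have h : ∀ c ∈ A.hyps, ∃ ζ ∈ LogAt c, ExteriorAlgebra.map ψ x = linP c ^ p • ζ := fun c hc => by
    obtain ⟨ζ, h1, h2⟩ := exists_smul_map_eq (A.ne_zero c hc)
      (fun f => mem_LogE.1 (hψ f) c hc) hx
    rw [pow_succ', mul_smul] at h2
    exact ⟨ζ, h1, smul_right_injective _ (linP_ne_zero (A.ne_zero c hc)) h2⟩
  obtain ⟨a, ha⟩ := exists_defPoly_smul (A := A) p (m := ExteriorAlgebra.map ψ x) fun c hc => by
    obtain ⟨ζ, -, h2⟩ := h c hc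
    exact ⟨ζ, h2⟩
  refine ⟨a, mem_LogE.2 fun c hc => ?_, by rw [ha, smul_smul, pow_succ']⟩
  obtain ⟨ζ, h1, h2⟩ := h c hc
  rw [ha, defPoly, ← Finset.mul_prod_erase _ _ hc, mul_pow, mul_smul] at h2
  have h3 := smul_right_injective _ (pow_ne_zero p (linP_ne_zero (A.ne_zero c hc))) h2
  rw [← h3] at h1
  refine mem_LogAt_of_smul_mem (IsRelPrime.pow_right (IsRelPrime.prod_right fun c' hc' => ?_)) h1
  exact isRelPrime_hyps hc (Finset.mem_of_mem_erase hc') (Finset.ne_of_mem_erase hc').symm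

lemma exists_eq_add_of_smul_eq_of_free [Module.Free (PS K ℓ) F]
    (hφ : ∀ c ∈ A.hyps, ∃ f, φ (fun i => C (c i)) = linP c • f)
    (hψ : ∀ f, ExteriorAlgebra.ι (PS K ℓ) (ψ f) ∈ LogE A)
    (hψφ : ψ ∘ₗ φ = defPoly A • LinearMap.id) {x y z : Fin ℓ → K} (hy : y ≠ 0)
    (hz : ∀ t : K, z ≠ t • y) (hx : ∀ s t : K, x ≠ s • y + t • z) {p : ℕ} {δ μ ν : ExtF K ℓ}
    (hδp : δ ∈ formsP K ℓ p) (hδ : δ ∈ LogE A) (hμ : μ ∈ LogE A) (hν : ν ∈ LogE A)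
    (h : linP x • δ = linP y • μ + linP z • ν) :
    ∃ a ∈ LogE A, ∃ b ∈ LogE A, δ = linP y • a + linP z • b := by
  have := free_exteriorAlgebra (PS K ℓ) F
  have hQ : defPoly A ≠ 0 := defPoly_ne_zero
  have hinj : Function.Injective fun x : ExteriorAlgebra (PS K ℓ) F => defPoly A • x :=
    smul_right_injective _ hQ
  obtain ⟨qδ, hqδ⟩ := exists_map_eq_defPoly_smul hφ hδ
  obtain ⟨qμ, hqμ⟩ := exists_map_eq_defPoly_smul hφ hμ
  obtain ⟨qν, hqν⟩ := exists_map_eq_defPoly_smul hφ hν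
  have h1 : linP x • qδ = linP y • qμ + linP z • qν := by
    have := congrArg (ExteriorAlgebra.map φ) h
    rw [map_add, map_smul, map_smul, map_smul, hqδ, hqμ, hqν, smul_comm, smul_comm (linP y),
      smul_comm (linP z), ← smul_add] at this
    exact hinj this
  have hqδp : degProj _ _ p qδ = qδ := by
    refine hinj ?_
    change defPoly A • _ = defPoly A • _
    rw [← map_smul, ← hqδ]
    exact degProj_of_mem (exteriorAlgebra_map_mem _ hδp)
  obtain ⟨a, b, hab⟩ := exists_eq_add_of_smul_eq hy hz hx h1
  obtain ⟨a', ha', ha⟩ := exists_defPoly_smul_map_eq hψ (degProj_mem p a)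
  obtain ⟨b', hb', hb⟩ := exists_defPoly_smul_map_eq hψ (degProj_mem p b)
  have h2 : defPoly A ^ p • δ = defPoly A ^ p • (linP y • a' + linP z • b') := by
    have h3 : defPoly A ^ p • δ = ExteriorAlgebra.map ψ (ExteriorAlgebra.map φ δ) := by
      rw [← exteriorAlgebra_map_smul_id _ hδp, ← hψφ, ← ExteriorAlgebra.map_comp_map,
        AlgHom.comp_apply]
    rw [h3, hqδ, map_smul, ← hqδp, hab, map_add, map_smul, map_smul, map_add, map_smul, map_smul,
      smul_add, smul_add, smul_comm, ha, smul_comm _ (linP z), hb, smul_comm _ (linP y),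
      smul_comm _ (linP z)]
  exact ⟨a', ha', b', hb', smul_right_injective _ (pow_ne_zero p hQ) h2⟩

end FreeModel

/-- Three independent linear forms are a regular sequence on the modules of logarithmic forms of
a free arrangement. -/
lemma FreeM.exists_eq_add_of_smul_eq (hA : FreeM A (fun _ => 1)) {x y z : Fin ℓ → K} (hy : y ≠ 0)
    (hz : ∀ t : K, z ≠ t • y) (hx : ∀ s t : K, x ≠ s • y + t • z) {p : ℕ} {δ μ ν : ExtF K ℓ}
    (hδ : δ ∈ Omega A (fun _ => 1) p) (hμ : μ ∈ LogE A) (hν : ν ∈ LogE A)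
    (h : linP x • δ = linP y • μ + linP z • ν) :
    ∃ a ∈ Omega A (fun _ => 1) p, ∃ b ∈ Omega A (fun _ => 1) p,
      δ = linP y • a + linP z • b := by
  have : Module.Free (PS K ℓ) (Omega A (fun _ => 1) 1) := hA
  obtain ⟨hδp, hδ'⟩ := mem_Omega_iff.1 hδ
  obtain ⟨a, ha, b, hb, hab⟩ := exists_eq_add_of_smul_eq_of_free (ψ := logOneVal A)
    (fun c hc => exists_logOneMul_eq hc)
    (fun f => by rw [ι_logOneVal]; exact (mem_Omega_iff.1 f.2).2) logOneVal_comp_logOneMul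
    hy hz hx hδp hδ' hμ hν h
  refine ⟨degProj _ _ p a, mem_Omega_iff.2 ⟨degProj_mem_formsP _ _, degProj_mem_LogE ha p⟩,
    degProj _ _ p b, mem_Omega_iff.2 ⟨degProj_mem_formsP _ _, degProj_mem_LogE hb p⟩, ?_⟩
  rw [← map_smul, ← map_smul, ← map_add, ← hab, degProj_of_mem_formsP hδp]

end FreeArrangement

section Surjectivity

lemma degProj_zero_dP_mul (c : Fin ℓ → K) (η : ExtF K ℓ) : degProj _ _ 0 (dP c * η) = 0 := by
  have hc : dP c ∈ ⋀[PS K ℓ]^1 (Fin ℓ → PS K ℓ) := dP_mem_formsP_one c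
  rw [degProj, GradedAlgebra.proj_apply]
  exact DirectSum.coe_decompose_mul_of_left_mem_of_not_le _ hc (by simp)

lemma degProj_one (p : ℕ) :
    degProj (PS K ℓ) (Fin ℓ → PS K ℓ) p 1 = if p = 0 then 1 else 0 := by
  have h : (1 : ExtF K ℓ) ∈ ⋀[PS K ℓ]^0 (Fin ℓ → PS K ℓ) := SetLike.GradedOne.one_mem
  split_ifs with hp
  · rw [hp, degProj_of_mem h]
  · rw [degProj, GradedAlgebra.proj_apply]
    exact DirectSum.decompose_of_mem_ne _ h (Ne.symm hp)

/-- The coefficient vectors of the linear forms lying in an ideal. -/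
def linForms (P : Ideal (PS K ℓ)) : Submodule K (Fin ℓ → K) where
  carrier := {c | linP c ∈ P}
  zero_mem' := by
    rw [Set.mem_ofPred_eq, linP_zero]
    exact P.zero_mem
  add_mem' := fun ha hb => by
    rw [Set.mem_ofPred_eq, linP_add]
    exact P.add_mem ha hb
  smul_mem' := fun t c hc => by
    rw [Set.mem_ofPred_eq, linP_smul]
    exact P.mul_mem_left _ hc

lemma exists_forall_mem_dotProduct_eq_zero {W : Submodule K (Fin ℓ → K)} (hW : W ≠ ⊤) :
    ∃ x : Fin ℓ → K, x ≠ 0 ∧ ∀ c ∈ W, c ⬝ᵥ x = 0 := by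
  obtain ⟨f, hf, hWf⟩ := Submodule.exists_le_ker_of_lt_top W (lt_top_iff_ne_top.2 hW)
  have key : ∀ c : Fin ℓ → K, c ⬝ᵥ (fun i => f (Pi.single i 1)) = f c := fun c => by
    conv_rhs => rw [← sum_smul_single c, map_sum]
    simp [dotProduct]
  refine ⟨fun i => f (Pi.single i 1), fun h => hf (LinearMap.ext fun c => ?_), fun c hc => ?_⟩
  · rw [← key, h, dotProduct_zero, LinearMap.zero_apply]
  · rw [key]
    exact hWf hc

variable {n : ℕ} {c₀ : Fin ℓ → K} {e : (Fin n → K) →ₗ[K] (Fin ℓ → K)}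

lemma pullE_degProj (e : (Fin n → K) →ₗ[K] (Fin ℓ → K)) (p : ℕ) (η : ExtF K ℓ) :
    pullE e (degProj _ _ p η) = degProj _ _ p (pullE e η) := by
  induction η using dP_induction generalizing p with
  | one =>
    rw [map_one (pullE e), degProj_one, degProj_one]
    split_ifs
    · exact map_one _
    · exact map_zero _
  | add x y hx hy => rw [map_add, map_add, map_add, map_add, hx, hy]
  | smul s x hx => rw [map_smul, pullE_smul, pullE_smul, map_smul, hx]
  | dmul c x hx =>
    rw [map_mul (pullE e), pullE_dP]
    rcases p with _ | p
    · rw [degProj_zero_dP_mul, degProj_zero_dP_mul, map_zero]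
    · rw [degProj_dP_mul, degProj_dP_mul, map_mul (pullE e), pullE_dP, hx]

variable (D : HypSplit c₀ e) {A : Arrangement K ℓ} {B : Arrangement K n}
include D

lemma HypSplit.mem_range_resMap (hB : ∀ b ∈ B.hyps, (fibre A c₀ e b).Nonempty) {p : ℕ}
    {ω : Omega B (fun _ => 1) p} {η : ExtF K ℓ} (hη : η ∈ LogE (delArr A c₀))
    (h : pullE e η = multPoly A c₀ e B • (ω : ExtF K n)) :
    ω ∈ Set.range (D.resMap hB p) := by
  refine ⟨⟨degProj _ _ p η, mem_Omega_iff.2 ⟨degProj_mem_formsP _ _, degProj_mem_LogE hη p⟩⟩,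
    D.resMap_eq hB ?_⟩
  rw [pullE_degProj, h, map_smul, degProj_of_mem_formsP (mem_Omega_iff.1 ω.2).1]

lemma HypSplit.prod_delArr_smul_mem_range (hB : ∀ b ∈ B.hyps, (fibre A c₀ e b).Nonempty) {p : ℕ}
    (ω : Omega B (fun _ => 1) p) :
    pull e (∏ c ∈ (delArr A c₀).hyps, linP c) • ω ∈ Set.range (D.resMap hB p) := by
  refine D.mem_range_resMap hB
    (defPoly_smul_mem_LogE (pullE D.q (multPoly A c₀ e B • (ω : ExtF K n)))) ?_
  rw [pullE_smul, D.pullE_pullE_q, smul_comm]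
  rfl

lemma HypSplit.prod_sdiff_fibre_smul_mem_range (hB : ∀ b ∈ B.hyps, (fibre A c₀ e b).Nonempty)
    {p : ℕ} (ω : Omega B (fun _ => 1) p) {b : Fin n → K} (hb : b ∈ B.hyps) :
    pull e (∏ c ∈ (delArr A c₀).hyps \ fibre A c₀ e b, linP c) • ω ∈
      Set.range (D.resMap hB p) := by
  obtain ⟨x, y, hxy⟩ := (mem_LogAt_iff (B.ne_zero b hb)).1 (mem_LogE.1 (mem_Omega_iff.1 ω.2).2 b hb)
  obtain ⟨d, hd⟩ := hB b hb
  obtain ⟨-, -, t, ht, hdt⟩ := mem_fibre.1 hd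
  obtain ⟨u, hu, hu'⟩ := exists_pull_prod_fibre (e := e) (s := fibre A c₀ e b)
    fun c hc => (mem_fibre.1 hc).2.2
  obtain ⟨r, hr, hr'⟩ := exists_pull_prod_fibre (e := e) (s := (fibre A c₀ e b).erase d)
    fun c hc => (mem_fibre.1 (Finset.mem_of_mem_erase hc)).2.2
  rw [Finset.card_erase_of_mem hd] at hr'
  have hcard : (fibre A c₀ e b).card = (fibre A c₀ e b).card - 1 + 1 :=
    (Nat.sub_add_cancel (Finset.card_pos.2 ⟨d, hd⟩)).symm
  set m := (fibre A c₀ e b).card - 1 with hm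
  rw [hcard] at hu'
  set G : PS K n := ∏ b' ∈ B.hyps.erase b, linP b' ^ ((fibre A c₀ e b').card - 1) with hG
  have hG' : multPoly A c₀ e B = linP b ^ m * G := (Finset.mul_prod_erase _ _ hb).symm
  refine D.mem_range_resMap hB (smul_prod_mem_LogE (s := (delArr A c₀).hyps \ fibre A c₀ e b) (η := pull D.q G •
    ((∏ c ∈ fibre A c₀ e b, linP c) • pullE D.q ((C u⁻¹ : PS K n) • x) +
    (∏ c ∈ (fibre A c₀ e b).erase d, linP c) •
      (dP d * pullE D.q ((C r⁻¹ : PS K n) • (C t⁻¹ : PS K n) • y)))) fun c hc hcs => ?_) ?_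
  · have hcF : c ∈ fibre A c₀ e b := by simpa [hc] using hcs
    refine Submodule.smul_mem _ _ (add_mem ?_ ?_)
    · rw [← Finset.mul_prod_erase _ _ hcF, mul_smul]
      exact smul_mem_LogAt _ _
    · by_cases hcd : c = d
      · rw [hcd]
        exact Submodule.smul_mem _ _ (dP_mul_mem_LogAt _ _)
      · rw [← Finset.mul_prod_erase _ _ (Finset.mem_erase.2 ⟨hcd, hcF⟩), mul_smul]
        exact smul_mem_LogAt _ _
  · change _ = multPoly A c₀ e B • _ • (ω : ExtF K n)
    rw [pullE_smul e, pullE_smul e, D.pull_pull_q, map_add, pullE_smul e, pullE_smul e, map_mul,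
      D.pullE_pullE_q, D.pullE_pullE_q, pullE_dP, hdt, dP_smul, hu', hr', hxy, hG',
      smul_mul_assoc, mul_smul_comm, mul_smul_comm]
    generalize pull e (∏ c ∈ (delArr A c₀).hyps \ fibre A c₀ e b, linP c) = s
    simp only [smul_add, smul_smul]
    have hC : ∀ {k : K}, k ≠ 0 → (C k * C k⁻¹ : PS K n) = 1 := fun hk => by
      rw [← C_mul, mul_inv_cancel₀ hk, C_1]
    congr 2
    · linear_combination (s * G * linP b ^ (m + 1)) * hC hu
    · linear_combination (s * G * linP b ^ m) * (C r * C r⁻¹ * hC ht + hC hr)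

/-- The regular sequence argument: a form whose multiples by two of three independent forms lift
along the restriction map lifts after localization, when the localization is free. -/
lemma HypSplit.pull_prod_smul_mem_range_of_freeM (hB : ∀ b ∈ B.hyps, (fibre A c₀ e b).Nonempty)
    (hc₀ : c₀ ∈ A.hyps) {A₀ : Arrangement K ℓ} (hA₀ : A₀.hyps ⊆ A.hyps)
    (hfree : FreeM A₀ (fun _ => 1)) (hc₀' : c₀ ∈ A₀.hyps) {y z : Fin ℓ → K} (hy : y ∈ A.hyps)
    (hz : z ∈ A.hyps) (hyz : z ≠ y) (hyc : pullForm e y ≠ 0) (hx : ∀ s t : K, c₀ ≠ s • y + t • z)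
    {p : ℕ} {ω : Omega B (fun _ => 1) p}
    (hyω : pull e (linP y) • ω ∈ Set.range (D.resMap hB p))
    (hzω : pull e (linP z) • ω ∈ Set.range (D.resMap hB p)) :
    pull e (∏ c ∈ A.hyps \ A₀.hyps, linP c) • ω ∈ Set.range (D.resMap hB p) := by
  obtain ⟨u, hu⟩ := hyω
  obtain ⟨v, hv⟩ := hzω
  have hLog : ∀ {η}, η ∈ LogE A → η ∈ LogE A₀ := fun h =>
    mem_LogE.2 fun c hc => mem_LogE.1 h c (hA₀ hc)
  have hmul : ∀ {η}, η ∈ LogE (delArr A c₀) → linP c₀ • η ∈ LogE A := fun h =>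
    (mem_LogE_iff_delArr hc₀).2 ⟨Submodule.smul_mem _ _ h, smul_mem_LogAt _ _⟩
  have hδ : linP z • (u : ExtF K ℓ) - linP y • (v : ExtF K ℓ) ∈ Omega A (fun _ => 1) p := by
    refine (D.resMap_eq_zero_iff hB hc₀ (η := linP z • u - linP y • v)).1 ?_
    rw [map_sub, LinearMap.map_smulₛₗ, LinearMap.map_smulₛₗ, hu, hv, smul_comm, sub_self]
  obtain ⟨hδ1, hδ2⟩ := mem_Omega_iff.1 hδ
  obtain ⟨hu1, hu2⟩ := mem_Omega_iff.1 u.2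
  obtain ⟨hv1, hv2⟩ := mem_Omega_iff.1 v.2
  obtain ⟨a, ha, b, hb, hab⟩ := hfree.exists_eq_add_of_smul_eq (A.ne_zero y hy)
    (A.nonprop z hz y hy hyz) hx (mem_Omega_iff.2 ⟨hδ1, hLog hδ2⟩)
    (neg_mem (hLog (hmul hv2))) (hLog (hmul hu2))
    (by rw [smul_sub, smul_neg, smul_comm, smul_comm (linP c₀) (linP y)]; abel)
  obtain ⟨ha1, ha2⟩ := mem_Omega_iff.1 ha
  obtain ⟨hb1, hb2⟩ := mem_Omega_iff.1 hb
  set s := ∏ c ∈ A.hyps \ A₀.hyps, linP c with hs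
  have hsLog : ∀ {η}, η ∈ LogE A₀ → s • η ∈ LogE A := fun h =>
    smul_prod_mem_LogE fun c hc hcs => mem_LogE.1 h c (by simpa [hc] using hcs)
  have huv : linP z • (s • (u : ExtF K ℓ) - s • b) = linP y • (s • (v : ExtF K ℓ) + s • a) := by
    rw [← smul_sub, ← smul_add, smul_comm, smul_comm (linP y), smul_sub, smul_add,
      sub_eq_iff_eq_add.1 hab]
    congr 1
    abel
  obtain ⟨w, hw⟩ := exists_eq_smul_of_isRelPrime (isRelPrime_hyps hy hz hyz.symm) huv
  have hw' : linP z • w = s • (v : ExtF K ℓ) + s • a := by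
    refine smul_right_injective _ (linP_ne_zero (A.ne_zero y hy)) ?_
    change linP y • linP z • w = _
    rw [smul_comm, ← hw, huv]
  have hyw : linP y • w ∈ LogE (delArr A c₀) := by
    rw [← hw]
    exact sub_mem (Submodule.smul_mem _ _ hu2) ((mem_LogE_iff_delArr hc₀).1 (hsLog hb2)).1
  have hzw : linP z • w ∈ LogE (delArr A c₀) := by
    rw [hw']
    exact add_mem (Submodule.smul_mem _ _ hv2) ((mem_LogE_iff_delArr hc₀).1 (hsLog ha2)).1
  refine D.mem_range_resMap hB (η := w) (mem_LogE.2 fun c hc => ?_) ?_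
  · have hcA := Finset.mem_of_mem_erase hc
    by_cases h : c = y
    · refine mem_LogAt_of_smul_mem (isRelPrime_hyps hcA hz ?_) (mem_LogE.1 hzw c hc)
      rw [h]
      exact hyz.symm
    · exact mem_LogAt_of_smul_mem (isRelPrime_hyps hcA hy h) (mem_LogE.1 hyw c hc)
  · have hb0 : pullE e (s • b) = 0 :=
      D.pullE_eq_zero_iff.2 (Submodule.smul_mem _ _ (mem_LogE.1 hb2 c₀ hc₀'))
    refine smul_right_injective _ (linP_ne_zero hyc) ?_
    change linP (pullForm e y) • pullE e w =
      linP (pullForm e y) • multPoly A c₀ e B • pull e s • (ω : ExtF K n)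
    rw [← pull_linP, ← pullE_smul, ← hw, map_sub, hb0, sub_zero, pullE_smul, ← D.smul_resMap hB,
      hu]
    change pull e s • multPoly A c₀ e B • pull e (linP y) • (ω : ExtF K n) = _
    rw [smul_comm, smul_comm (pull e s), smul_comm (multPoly A c₀ e B) (pull e (linP y))]

/-- The restriction map is surjective in low degrees. -/
lemma HypSplit.resMap_surjective (hB : ∀ b ∈ B.hyps, (fibre A c₀ e b).Nonempty)
    (hA : ∀ c ∈ A.hyps, c ≠ c₀ → ∃ b ∈ B.hyps, c ∈ fibre A c₀ e b) (hc₀ : c₀ ∈ A.hyps)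
    (hlf : LocallyFreeAlong A (fun _ => 1) c₀) {p : ℕ} (hp : p + 3 ≤ ℓ)
    (h1 : pdLE (PS K ℓ) p (Omega (delArr A c₀) (fun _ => 1) p))
    (h2 : pdLE (PS K ℓ) p (Omega A (fun _ => 1) p)) :
    Function.Surjective (D.resMap hB p) := by
  have : RingHomSurjective (pull e) := ⟨D.pull_surjective⟩
  by_contra hsurj
  obtain ⟨P, ω, hP, hω, hmem⟩ := exists_isPrime_of_not_surjective hsurj
  have hprod : ∀ {s : Finset (Fin ℓ → K)}, (∀ c ∈ s, linP c ∉ P) → ∏ c ∈ s, linP c ∉ P :=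
    fun h h' => by
      obtain ⟨c, hc, hcP⟩ := hP.prod_mem_iff.1 h'
      exact h c hc hcP
  have hc₀P : linP c₀ ∈ P := by
    rw [hmem, D.pull_self, zero_smul]
    exact zero_mem _
  by_cases hcase₁ : ∀ c ∈ (delArr A c₀).hyps, linP c ∉ P
  · exact hprod hcase₁ ((hmem _).2 (D.prod_delArr_smul_mem_range hB ω))
  push Not at hcase₁
  obtain ⟨y, hy, hyP⟩ := hcase₁
  obtain ⟨hyc₀, hyA⟩ := Finset.mem_erase.1 hy
  obtain ⟨b, hb, hyb⟩ := hA y hyA hyc₀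
  by_cases hcase₂ : ∀ c ∈ (delArr A c₀).hyps \ fibre A c₀ e b, linP c ∉ P
  · exact hprod hcase₂ ((hmem _).2 (D.prod_sdiff_fibre_smul_mem_range hB ω hb))
  push Not at hcase₂
  obtain ⟨z, hz, hzP⟩ := hcase₂
  obtain ⟨hz, hzb⟩ := Finset.mem_sdiff.1 hz
  obtain ⟨hzc₀, hzA⟩ := Finset.mem_erase.1 hz
  obtain ⟨-, -, t, ht, hyt⟩ := mem_fibre.1 hyb
  have hy0 : pullForm e y ≠ 0 := by
    rw [hyt]
    exact smul_ne_zero ht (B.ne_zero b hb)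
  by_cases hW : linForms P = ⊤
  · refine hω (mem_range_of_forall_smul_mem_range P (fun j => ?_) hp h1
      (pdLE_of_linearEquiv (D.nonempty_kerResMapEquiv hB p hc₀).some.symm h2) (fun m hm => ?_) ω
      fun s hs => (hmem s).1 hs)
    · have : Pi.single j (1 : K) ∈ linForms P := hW ▸ Submodule.mem_top
      rw [← linP_single]
      exact this
    · have h3 := congrArg (Subtype.val : Omega B (fun _ => 1) p → ExtF K n) (hm _ hyP)
      refine Subtype.ext ((smul_eq_zero_iff_right (linP_ne_zero hy0)).1 ?_)
      rw [← pull_linP]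
      exact h3
  obtain ⟨x, hx0, hx⟩ := exists_forall_mem_dotProduct_eq_zero hW
  refine hprod (s := A.hyps \ (locArr A x).hyps) (fun c hc hcP => ?_) ((hmem _).2
    (D.pull_prod_smul_mem_range_of_freeM hB hc₀ (Finset.filter_subset _ _)
      (hlf x hx0 (hx c₀ hc₀P)) (Finset.mem_filter.2 ⟨hc₀, hx c₀ hc₀P⟩) hyA hzA ?_ hy0 ?_
      ((hmem _).1 hyP) ((hmem _).1 hzP)))
  · rw [Finset.mem_sdiff] at hc
    exact hc.2 (Finset.mem_filter.2 ⟨hc.1, hx c hcP⟩)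
  · rintro rfl
    exact hzb hyb
  · intro r s hrs
    by_cases hs : s = 0
    · rw [hs, zero_smul, add_zero] at hrs
      exact A.nonprop c₀ hc₀ y hyA hyc₀.symm r hrs
    have h3 := congrArg (pullForm e) hrs
    rw [D.pullForm_self, map_add, map_smul, map_smul, hyt] at h3
    have h4 : pullForm e z = (-(s⁻¹ * (r * t))) • b := by
      rw [neg_smul, mul_smul, mul_smul, ← smul_neg, eq_inv_smul_iff₀ hs, eq_neg_iff_add_eq_zero,
        add_comm]
      exact h3.symm
    refine hzb (mem_fibre.2 ⟨hzA, hzc₀, _, fun h5 => ?_, h4⟩)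
    rw [h5, zero_smul] at h4
    obtain ⟨b', hb', hzb'⟩ := hA z hzA hzc₀
    obtain ⟨-, -, t', ht', hzt'⟩ := mem_fibre.1 hzb'
    exact smul_ne_zero ht' (B.ne_zero b' hb') (hzt'.symm.trans h4)

end Surjectivity

/-- **Restriction theorem for tameness.**  If `A` and `A' = A ∖ {H}` are both tame and `A`
is locally free along `H`, then the restriction `A^H` is tame. -/
theorem restriction_theorem_for_tameness
    {K : Type} [Field K] {ℓ : ℕ} (A : Arrangement K ℓ) (hess : Essential A)
    (c0 : Fin ℓ → K) (hc0 : c0 ∈ A.hyps)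
    (hA_tame : Tame A) (hdel_tame : Tame (delArr A c0))
    (hlf : LocallyFreeAlong A (fun _ => 1) c0) :
    ∀ (e : (Fin (ℓ - 1) → K) →ₗ[K] (Fin ℓ → K)) (B : Arrangement K (ℓ - 1)),
      IsHypEmbedding c0 e → IsRestrictionOf B A c0 e → Tame B := by
  rintro e B he ⟨hAB, hBA⟩ p hp
  obtain ⟨D⟩ := he.nonempty_hypSplit (A.ne_zero c0 hc0)
  have hB : ∀ b ∈ B.hyps, (fibre A c0 e b).Nonempty := fun b hb => by
    obtain ⟨c, hc, hcc0, ht⟩ := hBA b hb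
    exact ⟨c, mem_fibre.2 ⟨hc, hcc0, ht⟩⟩
  have hA : ∀ c ∈ A.hyps, c ≠ c0 → ∃ b ∈ B.hyps, c ∈ fibre A c0 e b := fun c hc hcc0 => by
    obtain ⟨b, hb, ht⟩ := hAB c hc hcc0
    exact ⟨b, hb, mem_fibre.2 ⟨hc, hcc0, ht⟩⟩
  rcases le_or_gt (ℓ - 1) (p + 2) with h | h
  · exact pdLE_Omega_of_le B h
  have h1 := hdel_tame p (by omega)
  have h2 := hA_tame p (by omega)
  exact pdLE_of_semilinear_surjective D.pull_surjective
    (IsRegular.of_ne_zero (linP_ne_zero (A.ne_zero c0 hc0))).left D.ker_pull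
    (globalDimLE_mvPolynomial K _) (D.resMap_surjective hB hA hc0 hlf (by omega) h1 h2) h1
    (pdLE_of_linearEquiv (D.nonempty_kerResMapEquiv hB p hc0).some.symm h2)
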